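/- arXiv:2201.07618 — 3 statements merged into one kernel-verified Lean document; each statement's English description precedes it below -/
import Mathlib

section
/- Let G be a bridgeless simple graph, let H be a bridgeless subgraph of G, and let s ≥ 2 be an integer such that every vertex of G is at distance at most s from V(H) in G. Suppose H has a strong orientation of diameter d. Then G has a strong orientation of diameter at most d + 4·binomial(s+1, 2) that extends the given orientation of H. -/
open SimpleGraph

/-- `D` is an orientation of the simple graph `G`: every arc of `D` lies along an edge of `G`,
and every edge of `G` receives exactly one of the two possible directions. -/
def IsOrientation {V : Type*} (G : SimpleGraph V) (D : V → V → Prop) : Prop :=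
  (∀ u v, D u v → G.Adj u v) ∧ ∀ u v, G.Adj u v → (D u v ↔ ¬ D v u)

/-- There is a directed walk of length `n` from `u` to `v` in the digraph with arc relation `D`. -/
def DiReach {V : Type*} (D : V → V → Prop) (u v : V) (n : ℕ) : Prop :=
  ∃ f : Fin (n + 1) → V, f 0 = u ∧ f (Fin.last n) = v ∧
    ∀ i : Fin n, D (f i.castSucc) (f i.succ)

/-- A graph is bridgeless if it is connected and none of its edges is a bridge. -/
def Bridgeless {V : Type*} (G : SimpleGraph V) : Prop :=
  G.Connected ∧ ∀ e : Sym2 V, ¬ G.IsBridge e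

/-- `hPoly δ g = 1 + δ + ∑_{i=1}^{⌊(g-1)/2⌋ - 1} δ (δ - 3)^i`. -/
def hPoly (δ g : ℕ) : ℕ :=
  1 + δ + ∑ i ∈ Finset.Icc 1 ((g - 1) / 2 - 1), δ * (δ - 3) ^ i

/-- `Steps R n u v` says that `v` is reached from `u` by exactly `n` steps of the relation `R`. -/
inductive Steps {V : Type*} (R : V → V → Prop) (u : V) : ℕ → V → Prop
  | refl : Steps R u 0 u
  | tail {n : ℕ} {v w : V} : Steps R u n v → R v w → Steps R u (n + 1) w

namespace Steps

variable {V : Type*} {R R' : V → V → Prop} {u v w : V} {m n : ℕ}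

theorem single (h : R u v) : Steps R u 1 v := refl.tail h

theorem trans (h₁ : Steps R u m v) (h₂ : Steps R v n w) : Steps R u (m + n) w := by
  induction h₂ with
  | refl => exact h₁
  | tail _ h ih => exact ih.tail h

theorem head (h : R u v) (h' : Steps R v n w) : Steps R u (n + 1) w := by
  rw [add_comm]
  exact (single h).trans h'

theorem mono (hR : ∀ x y, R x y → R' x y) (h : Steps R u n v) : Steps R' u n v := by
  induction h with
  | refl => exact refl
  | tail _ h ih => exact ih.tail (hR _ _ h)

theorem exists_head (h : Steps R u (n + 1) w) : ∃ v, R u v ∧ Steps R v n w := by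
  induction n generalizing w with
  | zero =>
    cases h with
    | tail h' hr => cases h' with
      | refl => exact ⟨_, hr, refl⟩
  | succ k ih =>
    cases h with
    | tail h' hr =>
      obtain ⟨v, hv, hs⟩ := ih h'
      exact ⟨v, hv, hs.tail hr⟩

theorem eq_of_zero (h : Steps R u 0 v) : u = v := by
  cases h
  rfl

theorem diReach (h : Steps R u n v) : DiReach R u v n := by
  induction h with
  | refl => exact ⟨fun _ => u, rfl, rfl, fun i => i.elim0⟩
  | @tail n v w _ hr ih =>
    obtain ⟨f, hf0, hfl, hf⟩ := ih
    refine ⟨Fin.snoc f w, ?_, Fin.snoc_last _ _, fun i => ?_⟩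
    · rw [← hf0, ← Fin.castSucc_zero, Fin.snoc_castSucc]
    · rw [Fin.snoc_castSucc]
      induction i using Fin.lastCases with
      | last => rwa [Fin.succ_last, Fin.snoc_last, hfl]
      | cast i =>
        rw [Fin.succ_castSucc, Fin.snoc_castSucc]
        exact hf i

end Steps

theorem DiReach.steps {V : Type*} {R : V → V → Prop} {u v : V} {n : ℕ} (h : DiReach R u v n) :
    Steps R u n v := by
  obtain ⟨f, rfl, rfl, hf⟩ := h
  suffices ∀ i : Fin (n + 1), Steps R (f 0) i (f i) from this (Fin.last n)
  intro i
  induction i using Fin.induction with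
  | zero => exact .refl
  | succ i ih => exact ih.tail (hf i)

theorem SimpleGraph.Walk.steps {V : Type*} {G : SimpleGraph V} {u v : V} (p : G.Walk u v) :
    Steps G.Adj u p.length v := by
  induction p with
  | nil => exact .refl
  | cons h _ ih => exact ih.head h

/-- An asymmetric set of arcs along edges of `G` extends to an orientation of `G`. -/
theorem exists_isOrientation_extending {V : Type*} (G : SimpleGraph V) (A : V → V → Prop)
    (hA : ∀ u v, A u v → G.Adj u v) (hasymm : ∀ u v, A u v → ¬ A v u) :
    ∃ D : V → V → Prop, IsOrientation G D ∧ ∀ u v, A u v → D u v := by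
  refine ⟨fun u v => A u v ∨ (G.Adj u v ∧ ¬ A v u ∧ WellOrderingRel u v), ⟨?_, ?_⟩,
    fun u v h => .inl h⟩
  · rintro u v (h | h)
    exacts [hA _ _ h, h.1]
  · intro u v huv
    have h₁ := hasymm u v
    have h₂ : WellOrderingRel u v → ¬ WellOrderingRel v u := fun h h' =>
      asymm_of WellOrderingRel h h'
    have h₃ : WellOrderingRel u v ∨ WellOrderingRel v u := by
      rcases trichotomous_of WellOrderingRel u v with h | h | h
      · exact .inl h
      · exact absurd h huv.ne
      · exact .inr h
    have h₄ := huv.symm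
    tauto

/-- The vertices of a finite graph can be two-coloured so that every non-isolated vertex has a
neighbour of the other colour. -/
theorem SimpleGraph.exists_set_forall_exists_adj_mem_iff_notMem {V : Type*} [Finite V]
    (B : SimpleGraph V) :
    ∃ I : Set V, ∀ v w, B.Adj v w → ∃ w', B.Adj v w' ∧ (w' ∈ I ↔ v ∉ I) := by
  obtain ⟨I, hI⟩ := Set.Finite.exists_maximal
    (Set.toFinite {I : Set V | ∀ x ∈ I, ∀ y ∈ I, ¬ B.Adj x y}) ⟨∅, by simp⟩
  refine ⟨I, fun v w hvw => ?_⟩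
  by_cases hv : v ∈ I
  · exact ⟨w, hvw, by simpa [hv] using fun hw => hI.1 v hv w hw hvw⟩
  · by_contra! hcon
    refine hv (hI.2 (y := insert v I) ?_ (Set.subset_insert _ _) (Set.mem_insert _ _))
    have hno : ∀ y ∈ I, ¬ B.Adj v y := fun y hy h => by
      have := hcon y h
      tauto
    rintro x (rfl | hx) y (rfl | hy) hxy
    · exact hxy.ne rfl
    · exact hno y hy hxy
    · exact hno x hx hxy.symm
    · exact hI.1 x hx y hy hxy

/-- In a bridgeless graph, for any `v` in a vertex set `T` and any `p` outside it, some edge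
other than `s(v, p)` leaves `T`. -/
theorem Bridgeless.exists_adj_of_mem_of_notMem {V : Type*} {G : SimpleGraph V} (hG : Bridgeless G)
    {v p : V} {T : Set V} (hv : v ∈ T) (hp : p ∉ T) :
    ∃ x ∈ T, ∃ y ∉ T, G.Adj x y ∧ s(x, y) ≠ s(v, p) := by
  have hb := hG.2 s(v, p)
  rw [SimpleGraph.isBridge_iff] at hb
  have hr : (G \ SimpleGraph.fromEdgeSet {s(v, p)}).Reachable v p := by
    by_contra h
    exact hb h
  obtain ⟨q⟩ := hr
  obtain ⟨d, -, hd₁, hd₂⟩ := q.exists_boundary_dart T hv hp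
  have hd := d.adj
  rw [SimpleGraph.sdiff_adj, SimpleGraph.fromEdgeSet_adj] at hd
  exact ⟨d.fst, hd₁, d.snd, hd₂, hd.1, fun h => hd.2 ⟨h, hd.1.ne⟩⟩

/-- A breadth-first forest grown from `S`: every vertex outside `S` has a depth, a parent and
the root of its branch, which is its ancestor of depth one. -/
theorem exists_bfs_forest {V : Type*} {G : SimpleGraph V} {S : Set V} {s : ℕ}
    (hS : ∀ v, ∃ u ∈ S, ∃ m ≤ s, Steps G.Adj u m v) :
    ∃ (δ : V → ℕ) (p br : V → V), (∀ v, δ v ≤ s) ∧ (∀ v, δ v = 0 ↔ v ∈ S) ∧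
      (∀ u ∈ S, ∀ v, G.Adj u v → δ v ≤ 1) ∧
      (∀ v ∉ S, G.Adj (p v) v ∧ δ v = δ (p v) + 1) ∧
      (∀ v ∉ S, p v ∈ S → br v = v) ∧ (∀ v ∉ S, p v ∉ S → br v = br (p v)) := by
  classical
  have hex : ∀ v, ∃ n, ∃ u ∈ S, Steps G.Adj u n v := fun v => by
    obtain ⟨u, hu, m, -, h⟩ := hS v
    exact ⟨m, u, hu, h⟩
  let δ : V → ℕ := fun v => Nat.find (hex v)
  have hspec : ∀ v, ∃ u ∈ S, Steps G.Adj u (δ v) v := fun v => Nat.find_spec (hex v)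
  have hmin : ∀ v n, ∀ u ∈ S, Steps G.Adj u n v → δ v ≤ n := fun v n u hu h =>
    Nat.find_min' (hex v) ⟨u, hu, h⟩
  have hzero : ∀ v, δ v = 0 ↔ v ∈ S := by
    refine fun v => ⟨fun h => ?_, fun h => Nat.le_zero.1 (hmin v 0 v h .refl)⟩
    obtain ⟨u, hu, hs⟩ := hspec v
    rw [h] at hs
    exact hs.eq_of_zero ▸ hu
  have hpar : ∀ v, ∃ p, v ∉ S → G.Adj p v ∧ δ v = δ p + 1 := by
    intro v
    by_cases hv : v ∈ S
    · exact ⟨v, fun h => absurd hv h⟩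
    obtain ⟨u, hu, hs⟩ := hspec v
    obtain ⟨n, hn⟩ := Nat.exists_eq_succ_of_ne_zero (mt (hzero v).1 hv)
    rw [hn] at hs
    cases hs with
    | @tail _ z _ h hz =>
      refine ⟨z, fun _ => ⟨hz, ?_⟩⟩
      have h₁ := hmin z n u hu h
      obtain ⟨u', hu', h'⟩ := hspec z
      have h₂ := hmin v _ u' hu' (h'.tail hz)
      omega
  choose p hp using hpar
  refine ⟨δ, p, fun v => p^[δ v - 1] v, fun v => ?_, hzero, fun u hu v huv => ?_, hp, ?_, ?_⟩
  · obtain ⟨u, hu, m, hm, h⟩ := hS v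
    exact (hmin v m u hu h).trans hm
  · exact hmin v 1 u hu (.single huv)
  · intro v hv hpv
    simp [(hp v hv).2, (hzero _).2 hpv]
  · intro v hv hpv
    obtain ⟨n, hn⟩ := Nat.exists_eq_succ_of_ne_zero (mt (hzero _).1 hpv)
    simp [(hp v hv).2, hn, Function.iterate_succ_apply]

/-- If every vertex of a bridgeless graph is within distance `s` of `S`, then some edges not
spanned by `S` can be oriented so that every neighbour of `S` outside `S` lies on a directed walk
of length at most `2 * s + 1` with both ends in `S`. -/
theorem Bridgeless.exists_short_ears {V : Type*} [Finite V] {G : SimpleGraph V}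
    (hG : Bridgeless G) {S : Set V} {s : ℕ}
    (hS : ∀ v, ∃ u ∈ S, ∃ m ≤ s, Steps G.Adj u m v) :
    ∃ D : V → V → Prop, (∀ u v, D u v → G.Adj u v) ∧ (∀ u v, D u v → ¬ D v u) ∧
      (∀ u v, D u v → ¬ (u ∈ S ∧ v ∈ S)) ∧
      ∀ u ∈ S, ∀ v ∉ S, G.Adj u v → ∃ x ∈ S, ∃ y ∈ S, ∃ a b, a + b ≤ 2 * s + 1 ∧
        Steps D x a v ∧ Steps D v b y := by
  obtain ⟨δ, p, br, hδs, hδ0, hδ1, hp, hbr, hbr'⟩ := exists_bfs_forest hS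
  let B : SimpleGraph V := SimpleGraph.fromRel fun v w =>
    ∃ x ∉ S, ∃ y ∉ S, br x = v ∧ br y = w ∧ G.Adj x y
  obtain ⟨I, hI⟩ := B.exists_set_forall_exists_adj_mem_iff_notMem
  let D : V → V → Prop := fun x y => G.Adj x y ∧
    ((y ∉ S ∧ p y = x ∧ br y ∈ I) ∨ (x ∉ S ∧ p x = y ∧ br x ∉ I) ∨
      (x ∉ S ∧ y ∉ S ∧ br x ∈ I ∧ br y ∉ I) ∨
      (x ∉ S ∧ y ∈ S ∧ p x ≠ y ∧ br x ∈ I) ∨ (x ∈ S ∧ y ∉ S ∧ p y ≠ x ∧ br y ∉ I))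
  have hbr_root : ∀ x ∉ S, br x ∉ S ∧ p (br x) ∈ S ∧ br (br x) = br x ∧
      (br x ∈ I → Steps D (br x) (δ x - 1) x) ∧ (br x ∉ I → Steps D x (δ x - 1) (br x)) := by
    intro x
    induction hn : δ x using Nat.strong_induction_on generalizing x with
    | _ n ih =>
      intro hx
      have hδ := (hp x hx).2
      by_cases hpx : p x ∈ S
      · have h0 := (hδ0 _).2 hpx
        have hn1 : n - 1 = 0 := by omega
        rw [hbr x hx hpx, hn1]
        exact ⟨hx, hpx, hbr x hx hpx, fun _ => .refl, fun _ => .refl⟩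
      · have h0 := mt (hδ0 _).1 hpx
        obtain ⟨h₁, h₂, h₃, h₄, h₅⟩ := ih (δ (p x)) (by omega) (p x) rfl hpx
        have hb := hbr' x hx hpx
        have hn1 : n - 1 = δ (p x) - 1 + 1 := by omega
        rw [hn1, hb]
        refine ⟨h₁, h₂, h₃, fun h => (h₄ h).tail ?_, fun h => (h₅ h).head ?_⟩
        · exact ⟨(hp x hx).1, .inl ⟨hx, rfl, hb ▸ h⟩⟩
        · exact ⟨(hp x hx).1.symm, .inr (.inl ⟨hx, rfl, hb ▸ h⟩)⟩
  have hdown : ∀ v ∉ S, br v = v → v ∈ I → D (p v) v := fun v hv hb h =>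
    ⟨(hp v hv).1, .inl ⟨hv, rfl, hb.symm ▸ h⟩⟩
  have hup : ∀ v ∉ S, br v = v → v ∉ I → D v (p v) := fun v hv hb h =>
    ⟨(hp v hv).1.symm, .inr (.inl ⟨hv, rfl, hb.symm ▸ h⟩)⟩
  have hcross : ∀ x ∉ S, ∀ y ∉ S, G.Adj x y → br x ∈ I → br y ∉ I → D x y :=
    fun x hx y hy hxy h h' => ⟨hxy, .inr (.inr (.inl ⟨hx, hy, h, h'⟩))⟩
  have hpos : ∀ x ∉ S, δ x ≠ 0 := fun x hx => mt (hδ0 x).1 hx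
  refine ⟨D, fun u v h => h.1, ?_, ?_, ?_⟩
  · have hcyc : ∀ x ∉ S, ∀ y ∉ S, p x = y → p y ≠ x := by
      intro x hx y hy h h'
      have h₁ := (hp x hx).2
      have h₂ := (hp y hy).2
      rw [h] at h₁
      rw [h'] at h₂
      omega
    have hbrp : ∀ x ∉ S, ∀ y ∉ S, p x = y → br x = br y := by
      rintro x hx y hy rfl
      exact hbr' x hx hy
    rintro u v ⟨-, h⟩ ⟨-, h'⟩
    have h₁ : u ∉ S → v ∉ S → p u = v → p v ≠ u := fun hu => hcyc u hu v
    have h₂ : u ∉ S → v ∉ S → p u = v → (br u ∈ I ↔ br v ∈ I) := fun hu hv e => by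
      rw [hbrp u hu v hv e]
    have h₃ : u ∉ S → v ∉ S → p v = u → (br u ∈ I ↔ br v ∈ I) := fun hu hv e => by
      rw [hbrp v hv u hu e]
    clear * - h h' h₁ h₂ h₃
    tauto
  · rintro u v ⟨-, h⟩ ⟨hu, hv⟩
    tauto
  · intro u hu v hv huv
    have hpv : p v ∈ S := by
      have h₁ := (hp v hv).2
      have h₂ := hδ1 u hu v huv
      exact (hδ0 _).1 (by omega)
    have hbv := hbr v hv hpv
    obtain ⟨x, ⟨hxS, hxv⟩, y, hy, hxy, hne⟩ := hG.exists_adj_of_mem_of_notMem (v := v) (p := p v)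
      (T := {x | x ∉ S ∧ br x = v}) ⟨hv, hbv⟩ (fun h => h.1 hpv)
    obtain ⟨-, -, -, hx₁, hx₂⟩ := hbr_root x hxS
    rw [hxv] at hx₁ hx₂
    have hδx := hδs x
    have hδx' := hpos x hxS
    by_cases hyS : y ∈ S
    · have hpx : p x ≠ y := by
        rintro rfl
        have := hbr x hxS hyS
        exact hne (by rw [← hxv, this])
      by_cases hvI : v ∈ I
      · exact ⟨p v, hpv, y, hyS, 1, δ x - 1 + 1, by omega, .single (hdown v hv hbv hvI),
          (hx₁ hvI).tail ⟨hxy, .inr (.inr (.inr (.inl ⟨hxS, hyS, hpx, by rwa [hxv]⟩)))⟩⟩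
      · exact ⟨y, hyS, p v, hpv, δ x - 1 + 1, 1, by omega,
          (hx₂ hvI).head ⟨hxy.symm, .inr (.inr (.inr (.inr ⟨hyS, hxS, hpx, by rwa [hxv]⟩)))⟩,
          .single (hup v hv hbv hvI)⟩
    · have hbxy : v ≠ br y := fun h => hy ⟨hyS, h.symm⟩
      obtain ⟨w, hvw, hw⟩ := hI v (br y) (by
        rw [SimpleGraph.fromRel_adj]
        exact ⟨hbxy, .inl ⟨x, hxS, y, hyS, hxv, rfl, hxy⟩⟩)
      obtain ⟨x, hxS, y, hyS, hxv, hyw, hxy⟩ :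
          ∃ x ∉ S, ∃ y ∉ S, br x = v ∧ br y = w ∧ G.Adj x y := by
        rw [SimpleGraph.fromRel_adj] at hvw
        rcases hvw.2 with h | ⟨x, hx, y, hy, hxw, hyv, hxy⟩
        · exact h
        · exact ⟨y, hy, x, hx, hyv, hxw, hxy.symm⟩
      obtain ⟨-, -, -, hx₁, hx₂⟩ := hbr_root x hxS
      obtain ⟨hwS, hpw, hbw, hy₁, hy₂⟩ := hbr_root y hyS
      rw [hxv] at hx₁ hx₂
      rw [hyw] at hwS hpw hbw hy₁ hy₂
      have hδx := hδs x
      have hδx' := hpos x hxS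
      have hδy := hδs y
      have hδy' := hpos y hyS
      by_cases hvI : v ∈ I
      · have hwI : w ∉ I := fun h => hw.1 h hvI
        have hxy' := hcross x hxS y hyS hxy (by rwa [hxv]) (by rwa [hyw])
        exact ⟨p v, hpv, p w, hpw, 1, δ x - 1 + 1 + (δ y - 1) + 1, by omega,
          .single (hdown v hv hbv hvI),
          (((hx₁ hvI).tail hxy').trans (hy₂ hwI)).tail (hup w hwS hbw hwI)⟩
      · have hwI : w ∈ I := hw.2 hvI
        have hxy' := hcross y hyS x hxS hxy.symm (by rwa [hyw]) (by rwa [hxv])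
        exact ⟨p w, hpw, p v, hpv, δ y - 1 + 1 + (δ x - 1 + 1), 1, by omega,
          ((hy₁ hwI).head (hdown w hwS hbw hwI)).trans
            ((hx₂ hvI).head hxy'), .single (hup v hv hbv hvI)⟩

/-- If every vertex of a bridgeless graph is within distance `s` of `S`, then some edges not
spanned by `S` can be oriented so that every vertex reaches `S`, and is reached from `S`, by a
directed walk of length at most `s * (s + 1)`. -/
theorem Bridgeless.exists_partial_orientation {V : Type*} [Finite V] {G : SimpleGraph V}
    (hG : Bridgeless G) (s : ℕ) (S : Set V)
    (hS : ∀ v, ∃ u ∈ S, ∃ m ≤ s, Steps G.Adj u m v) :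
    ∃ D : V → V → Prop, (∀ u v, D u v → G.Adj u v) ∧ (∀ u v, D u v → ¬ D v u) ∧
      (∀ u v, D u v → ¬ (u ∈ S ∧ v ∈ S)) ∧
      ∀ v, (∃ x ∈ S, ∃ m ≤ s * (s + 1), Steps D x m v) ∧
        ∃ y ∈ S, ∃ m ≤ s * (s + 1), Steps D v m y := by
  induction s generalizing S with
  | zero =>
    have hmem : ∀ v, v ∈ S := fun v => by
      obtain ⟨u, hu, m, hm, h⟩ := hS v
      obtain rfl := Nat.le_zero.1 hm
      exact h.eq_of_zero ▸ hu
    exact ⟨fun _ _ => False, by simp, by simp, by simp, fun v =>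
      ⟨⟨v, hmem v, 0, le_rfl, .refl⟩, ⟨v, hmem v, 0, le_rfl, .refl⟩⟩⟩
  | succ s ih =>
    obtain ⟨D, hD, hDasymm, hDS, hears⟩ := hG.exists_short_ears hS
    let S' : Set V := {v | ∃ x ∈ S, ∃ y ∈ S, ∃ a b, a + b ≤ 2 * (s + 1) + 1 ∧
      Steps D x a v ∧ Steps D v b y}
    have hSS' : S ⊆ S' := fun v hv => ⟨v, hv, v, hv, 0, 0, by omega, .refl, .refl⟩
    let D₁ : V → V → Prop := fun u v => D u v ∧ u ∈ S' ∧ v ∈ S'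
    have hfrom : ∀ x ∈ S, ∀ y ∈ S, ∀ a v, Steps D x a v → ∀ b, a + b ≤ 2 * (s + 1) + 1 →
        Steps D v b y → Steps D₁ x a v := by
      intro x hx y hy a v h
      induction h with
      | refl => exact fun _ _ _ => .refl
      | @tail n v w h hvw ih =>
        intro b hb hw
        exact (ih (b + 1) (by omega) (hw.head hvw)).tail ⟨hvw,
          ⟨x, hx, y, hy, n, b + 1, by omega, h, hw.head hvw⟩,
          ⟨x, hx, y, hy, n + 1, b, by omega, h.tail hvw, hw⟩⟩
    have hto : ∀ x ∈ S, ∀ y ∈ S, ∀ b a v, Steps D x a v → a + b ≤ 2 * (s + 1) + 1 →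
        Steps D v b y → Steps D₁ v b y := by
      intro x hx y hy b
      induction b with
      | zero => exact fun a v _ _ h => h.eq_of_zero ▸ .refl
      | succ b ih =>
        intro a v hv hab h
        obtain ⟨w, hvw, hw⟩ := h.exists_head
        exact (ih (a + 1) w (hv.tail hvw) (by omega) hw).head ⟨hvw,
          ⟨x, hx, y, hy, a, b + 1, by omega, hv, h⟩,
          ⟨x, hx, y, hy, a + 1, b, by omega, hv.tail hvw, hw⟩⟩
    have hshort : ∀ v ∈ S', (∃ x ∈ S, ∃ m ≤ 2 * (s + 1), Steps D₁ x m v) ∧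
        ∃ y ∈ S, ∃ m ≤ 2 * (s + 1), Steps D₁ v m y := by
      intro v hv
      by_cases hvS : v ∈ S
      · exact ⟨⟨v, hvS, 0, by omega, .refl⟩, ⟨v, hvS, 0, by omega, .refl⟩⟩
      obtain ⟨x, hx, y, hy, a, b, hab, hxv, hvy⟩ := hv
      have ha : a ≠ 0 := by
        rintro rfl
        exact hvS (hxv.eq_of_zero ▸ hx)
      have hb : b ≠ 0 := by
        rintro rfl
        exact hvS (hvy.eq_of_zero ▸ hy)
      exact ⟨⟨x, hx, a, by omega, hfrom x hx y hy a v hxv b hab hvy⟩,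
        ⟨y, hy, b, by omega, hto x hx y hy b a v hxv hab hvy⟩⟩
    obtain ⟨D₂, hD₂, hD₂asymm, hD₂S, hreach⟩ := ih S' (by
      intro v
      obtain ⟨u, hu, m, hm, h⟩ := hS v
      cases m with
      | zero => exact ⟨u, hSS' hu, 0, by omega, h⟩
      | succ m =>
        obtain ⟨z, huz, hz⟩ := h.exists_head
        refine ⟨z, ?_, m, by omega, hz⟩
        by_cases hzS : z ∈ S
        · exact hSS' hzS
        · exact hears u hu z hzS huz)
    refine ⟨fun u v => D₁ u v ∨ D₂ u v, ?_, ?_, ?_, ?_⟩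
    · rintro u v (h | h)
      exacts [hD u v h.1, hD₂ u v h]
    · rintro u v (h | h) (h' | h')
      · exact hDasymm u v h.1 h'.1
      · exact hD₂S v u h' ⟨h.2.2, h.2.1⟩
      · exact hD₂S u v h ⟨h'.2.2, h'.2.1⟩
      · exact hD₂asymm u v h h'
    · rintro u v (h | h) ⟨hu, hv⟩
      · exact hDS u v h.1 ⟨hu, hv⟩
      · exact hD₂S u v h ⟨hSS' hu, hSS' hv⟩
    · intro v
      have hsum : (s + 1) * (s + 1 + 1) = 2 * (s + 1) + s * (s + 1) := by ring
      rw [hsum]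
      obtain ⟨⟨x', hx', m, hm, hm'⟩, ⟨y', hy', n, hn, hn'⟩⟩ := hreach v
      obtain ⟨⟨x, hx, a, ha, ha'⟩, -⟩ := hshort x' hx'
      obtain ⟨-, ⟨y, hy, b, hb, hb'⟩⟩ := hshort y' hy'
      exact ⟨⟨x, hx, a + m, by omega,
          (ha'.mono fun _ _ => .inl).trans (hm'.mono fun _ _ => .inr)⟩,
        ⟨y, hy, n + b, by omega,
          (hn'.mono fun _ _ => .inr).trans (hb'.mono fun _ _ => .inl)⟩⟩

/-- Let `G` be a bridgeless graph, `H` a bridgeless subgraph of `G`, and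
`s ≥ 2` an integer such that every vertex of `G` is at distance at most `s` from `V(H)`.
If `H` has a strong orientation of diameter `d`, then `G` has a strong orientation of diameter
at most `d + 4·C(s+1, 2)` extending the given orientation of `H`. -/
theorem orientation_extension_of_dist_le
    {V : Type*} [Fintype V] (G : SimpleGraph V)
    (hG : Bridgeless G) (H : G.Subgraph) (hH : Bridgeless H.coe)
    (s : ℕ) (hs : 2 ≤ s)
    (hdist : ∀ v : V, ∃ u ∈ H.verts, G.dist v u ≤ s)
    (d : ℕ) (DH : ↥H.verts → ↥H.verts → Prop)
    (hDH : IsOrientation H.coe DH)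
    (hDHd : ∀ u v : ↥H.verts, ∃ m ≤ d, DiReach DH u v m) :
    ∃ D : V → V → Prop, IsOrientation G D ∧
      (∀ u v : V, ∃ m ≤ d + 4 * Nat.choose (s + 1) 2, DiReach D u v m) ∧
      ∀ (u v : V) (hu : u ∈ H.verts) (hv : v ∈ H.verts),
        H.Adj u v → (DH ⟨u, hu⟩ ⟨v, hv⟩ ↔ D u v) := by
  obtain ⟨D₀, hD₀, hD₀asymm, hD₀S, hreach⟩ := hG.exists_partial_orientation s H.verts (by
    intro v
    obtain ⟨u, hu, h⟩ := hdist v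
    obtain ⟨p, hp⟩ := hG.1.exists_walk_length_eq_dist u v
    exact ⟨u, hu, p.length, by rwa [hp, SimpleGraph.dist_comm], p.steps⟩)
  let L : V → V → Prop := fun u v => ∃ (hu : u ∈ H.verts) (hv : v ∈ H.verts), DH ⟨u, hu⟩ ⟨v, hv⟩
  obtain ⟨D, hD, hDext⟩ := exists_isOrientation_extending G (fun u v => D₀ u v ∨ L u v) (by
      rintro u v (h | ⟨hu, hv, h⟩)
      · exact hD₀ u v h
      · exact H.adj_sub (hDH.1 _ _ h)) (by
      rintro u v (h | ⟨hu, hv, h⟩) (h' | ⟨hv', hu', h'⟩)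
      · exact hD₀asymm u v h h'
      · exact hD₀S u v h ⟨hu', hv'⟩
      · exact hD₀S v u h' ⟨hv, hu⟩
      · exact (hDH.2 _ _ (hDH.1 _ _ h)).1 h h')
  refine ⟨D, hD, fun u v => ?_, fun u v hu hv huv => ⟨fun h => hDext u v (.inr ⟨hu, hv, h⟩),
    fun h => ?_⟩⟩
  · obtain ⟨x, hx, a, ha, hux⟩ := (hreach u).2
    obtain ⟨y, hy, b, hb, hyv⟩ := (hreach v).1
    obtain ⟨m, hm, f, hf0, hfl, hf⟩ := hDHd ⟨x, hx⟩ ⟨y, hy⟩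
    have hxy : DiReach D x y m := ⟨fun i => f i, congrArg Subtype.val hf0,
      congrArg Subtype.val hfl,
      fun i => hDext _ _ (.inr ⟨(f i.castSucc).2, (f i.succ).2, hf i⟩)⟩
    have hchoose : 4 * Nat.choose (s + 1) 2 = s * (s + 1) + s * (s + 1) := by
      rw [Nat.choose_two_right, Nat.add_sub_cancel, mul_comm (s + 1) s]
      have := Nat.div_mul_cancel (Nat.even_mul_succ_self s).two_dvd
      omega
    have hmono : ∀ z w, D₀ z w → D z w := fun z w h => hDext z w (.inl h)
    exact ⟨a + m + b, by omega, (((hux.mono hmono).trans hxy.steps).trans (hyv.mono hmono)).diReach⟩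
  · by_contra hn
    have h' : DH ⟨v, hv⟩ ⟨u, hu⟩ := (hDH.2 _ _ (show H.coe.Adj ⟨v, hv⟩ ⟨u, hu⟩ from huv.symm)).2 hn
    exact (hD.2 u v (H.adj_sub huv)).1 h (hDext v u (.inr ⟨hv, hu, h'⟩))
end

section
/- Let G be a bridgeless simple graph and H a bridgeless subgraph of G such that every vertex of G is at distance at most 1 from V(H) in G. If H has a strong orientation of diameter d, then G has a strong orientation of diameter at most d + 4. -/
open SimpleGraph

namespace DiReach

variable {V : Type*} {D : V → V → Prop}

theorem refl (u : V) : DiReach D u u 0 :=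
  ⟨fun _ => u, rfl, rfl, fun i => i.elim0⟩

theorem cons {u v w : V} {n : ℕ} (h : D u v) (hvw : DiReach D v w n) :
    DiReach D u w (n + 1) := by
  obtain ⟨f, hf0, hfn, hf⟩ := hvw
  refine ⟨Fin.cons u f, rfl, ?_, fun i => ?_⟩
  · rw [← Fin.succ_last, Fin.cons_succ, hfn]
  · refine Fin.cases ?_ (fun j => ?_) i
    · simpa [hf0] using h
    · simpa [← Fin.succ_castSucc] using hf j

theorem single {u v : V} (h : D u v) : DiReach D u v 1 :=
  (refl v).cons h

theorem trans {u v w : V} {m n : ℕ} (huv : DiReach D u v m) (hvw : DiReach D v w n) :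
    DiReach D u w (m + n) := by
  induction m generalizing u with
  | zero =>
    obtain ⟨f, rfl, rfl, -⟩ := huv
    simpa using hvw
  | succ m ih =>
    obtain ⟨f, rfl, hfm, hf⟩ := huv
    have htail : DiReach D (f 1) v m :=
      ⟨fun i => f i.succ, rfl, by simpa using hfm, fun i => by simpa using hf i.succ⟩
    have hcons := (ih htail).cons (by simpa using hf 0)
    exact Nat.add_right_comm m n 1 ▸ hcons

theorem map {W : Type*} {E : W → W → Prop} (φ : V → W) (hφ : ∀ a b, D a b → E (φ a) (φ b))
    {u v : V} {n : ℕ} (h : DiReach D u v n) : DiReach E (φ u) (φ v) n := by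
  obtain ⟨f, rfl, rfl, hf⟩ := h
  exact ⟨φ ∘ f, rfl, rfl, fun i => hφ _ _ (hf i)⟩

end DiReach

/-- Every asymmetric relation along the edges of a graph extends to an orientation. -/
theorem exists_isOrientation_of_asymm {V : Type*} (G : SimpleGraph V) (R : V → V → Prop)
    (hadj : ∀ u v, R u v → G.Adj u v) (hasymm : ∀ u v, R u v → ¬ R v u) :
    ∃ D : V → V → Prop, IsOrientation G D ∧ ∀ u v, R u v → D u v := by
  let r : V → V → Prop := WellOrderingRel
  refine ⟨fun u v => G.Adj u v ∧ (R u v ∨ (¬ R v u ∧ r u v)), ⟨fun u v h => h.1, ?_⟩,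
    fun u v h => ⟨hadj u v h, Or.inl h⟩⟩
  intro u v huv
  have htri : r u v ∨ u = v ∨ r v u := trichotomous_of WellOrderingRel u v
  have hr : r u v → ¬ r v u := fun h h' => asymm_of WellOrderingRel h h'
  have hne := huv.ne
  have hsymm := huv.symm
  have h₁ := hasymm u v
  tauto

/-- Every vertex set of a finite graph has a maximal independent subset, which dominates it. -/
theorem exists_independent_dominating {V : Type*} [Finite V] (G : SimpleGraph V) (W : Set V) :
    ∃ A ⊆ W, (∀ u ∈ A, ∀ v ∈ A, ¬ G.Adj u v) ∧ ∀ v ∈ W, v ∉ A → ∃ u ∈ A, G.Adj u v := by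
  obtain ⟨A, hA⟩ := Set.Finite.exists_maximal
    (s := {A : Set V | A ⊆ W ∧ ∀ u ∈ A, ∀ v ∈ A, ¬ G.Adj u v}) (Set.toFinite _)
    ⟨∅, by simp⟩
  refine ⟨A, hA.prop.1, hA.prop.2, fun v hvW hvA => ?_⟩
  by_contra! hv
  refine hvA (hA.le_of_ge (y := insert v A) ⟨Set.insert_subset hvW hA.prop.1, ?_⟩
    (Set.subset_insert v A) (Set.mem_insert v A))
  rintro u (rfl | hu) w (rfl | hw) huw
  · exact huw.ne rfl
  · exact hv w hw huw.symm
  · exact hv u hu huw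
  · exact hA.prop.2 u hu w hw huw

/-- In a bridgeless graph, a vertex with a neighbor has a second neighbor. -/
theorem Bridgeless.exists_adj_ne {V : Type*} {G : SimpleGraph V} (hG : Bridgeless G) {u v : V}
    (huv : G.Adj u v) : ∃ w, G.Adj u w ∧ w ≠ v := by
  by_contra! h
  refine hG.2 s(u, v) ?_
  rw [SimpleGraph.isBridge_iff]
  rintro ⟨p⟩
  cases p with
  | nil => exact huv.ne rfl
  | cons hadj _ =>
    rw [SimpleGraph.deleteEdges_adj] at hadj
    exact hadj.2 (by rw [h _ hadj.1]; rfl)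

/-- Let `G` be a bridgeless graph and `H` a bridgeless subgraph of `G` with
every vertex of `G` at distance at most `1` from `V(H)`. If `H` has a strong orientation of
diameter `d`, then `G` has a strong orientation of diameter at most `d + 4`. -/
theorem orientation_of_dist_le_one
    {V : Type*} [Fintype V] (G : SimpleGraph V)
    (hG : Bridgeless G) (H : G.Subgraph) (hH : Bridgeless H.coe)
    (hdist : ∀ v : V, ∃ u ∈ H.verts, G.dist v u ≤ 1)
    (d : ℕ) (DH : ↥H.verts → ↥H.verts → Prop)
    (hDH : IsOrientation H.coe DH)
    (hDHd : ∀ u v : ↥H.verts, ∃ m ≤ d, DiReach DH u v m) :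
    ∃ D : V → V → Prop, IsOrientation G D ∧
      ∀ u v : V, ∃ m ≤ d + 4, DiReach D u v m := by
  have hp : ∀ v, ∃ u, v ∉ H.verts → u ∈ H.verts ∧ G.Adj v u := by
    intro v
    obtain ⟨u, hu, hvu⟩ := hdist v
    refine ⟨u, fun hv => ⟨hu, ?_⟩⟩
    have hpos := hG.1.pos_dist_of_ne (u := v) (v := u) (by rintro rfl; exact hv hu)
    exact SimpleGraph.dist_eq_one_iff_adj.mp (by omega)
  choose p hp using hp
  have hq : ∀ v, ∃ w, v ∉ H.verts → G.Adj v w ∧ w ≠ p v := by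
    intro v
    by_cases hv : v ∈ H.verts
    · exact ⟨v, fun h => absurd hv h⟩
    · obtain ⟨w, hw⟩ := hG.exists_adj_ne (hp v hv).2
      exact ⟨w, fun _ => hw⟩
  choose q hq using hq
  obtain ⟨A, hAW, hind, hdom⟩ := exists_independent_dominating G H.vertsᶜ
  have hAS : ∀ v ∈ A, v ∉ H.verts := fun v hv => hAW hv
  /- Arcs of `H` are kept; the others run from `H` into `A`, from `A` to the remaining vertices,
  and from those back to `H`. If the second neighbor `q u` of `u ∈ A` lies in `H`, it is used
  for going back directly. -/
  let R : V → V → Prop := fun u v =>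
    (∃ (hu : u ∈ H.verts) (hv : v ∈ H.verts), DH ⟨u, hu⟩ ⟨v, hv⟩) ∨
    (u ∈ A ∧ v ∉ A ∧ v ∉ H.verts ∧ G.Adj u v) ∨
    (v ∈ A ∧ u = p v) ∨
    (u ∉ A ∧ u ∉ H.verts ∧ v = p u) ∨
    (u ∈ A ∧ v ∈ H.verts ∧ v = q u)
  obtain ⟨D, hD, hRD⟩ := exists_isOrientation_of_asymm G R
    (by
      rintro u v (⟨hu, hv, h⟩ | h | ⟨hv, rfl⟩ | ⟨-, hu, rfl⟩ | ⟨hu, -, rfl⟩)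
      · exact H.adj_sub (hDH.1 _ _ h)
      · exact h.2.2.2
      · exact (hp v (hAS v hv)).2.symm
      · exact (hp u hu).2
      · exact (hq u (hAS u hu)).1)
    (by
      rintro u v (⟨hu, hv, h⟩ | h | h | h | h) (⟨hu', hv', h'⟩ | h' | h' | h' | h')
      · exact (hDH.2 _ _ (hDH.1 _ _ h)).mp h h'
      all_goals grind)
  have hout : ∀ u, ∃ (s : H.verts), ∃ k ≤ 2, DiReach D u s k := by
    intro u
    by_cases hu : u ∈ H.verts
    · exact ⟨⟨u, hu⟩, 0, by omega, .refl u⟩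
    have hB : ∀ v, v ∉ H.verts → v ∉ A → D v (p v) := fun v hv hvA =>
      hRD _ _ (.inr (.inr (.inr (.inl ⟨hvA, hv, rfl⟩))))
    by_cases huA : u ∈ A
    · by_cases hqu : q u ∈ H.verts
      · exact ⟨⟨q u, hqu⟩, 1, by omega,
          .single (hRD _ _ (.inr (.inr (.inr (.inr ⟨huA, hqu, rfl⟩)))))⟩
      · have hqA : q u ∉ A := fun h => hind u huA _ h (hq u hu).1
        exact ⟨⟨p (q u), (hp _ hqu).1⟩, 2, le_rfl, (DiReach.single (hB _ hqu hqA)).cons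
          (hRD _ _ (.inr (.inl ⟨huA, hqA, hqu, (hq u hu).1⟩)))⟩
    · exact ⟨⟨p u, (hp u hu).1⟩, 1, by omega, .single (hB u hu huA)⟩
  have hin : ∀ v, ∃ (s : H.verts), ∃ k ≤ 2, DiReach D s v k := by
    intro v
    by_cases hv : v ∈ H.verts
    · exact ⟨⟨v, hv⟩, 0, by omega, .refl v⟩
    have hA : ∀ w ∈ A, D (p w) w := fun w hw => hRD _ _ (.inr (.inr (.inl ⟨hw, rfl⟩)))
    by_cases hvA : v ∈ A
    · exact ⟨⟨p v, (hp v hv).1⟩, 1, by omega, .single (hA v hvA)⟩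
    · obtain ⟨w, hwA, hwv⟩ := hdom v hv hvA
      exact ⟨⟨p w, (hp w (hAS w hwA)).1⟩, 2, le_rfl, (DiReach.single
        (hRD _ _ (.inr (.inl ⟨hwA, hvA, hv, hwv⟩)))).cons (hA w hwA)⟩
  refine ⟨D, hD, fun u v => ?_⟩
  obtain ⟨s, k, hk, hus⟩ := hout u
  obtain ⟨t, l, hl, htv⟩ := hin v
  obtain ⟨m, hm, hst⟩ := hDHd s t
  have hst' : DiReach D s t m :=
    hst.map Subtype.val fun a b h => hRD _ _ (.inl ⟨a.2, b.2, h⟩)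
  exact ⟨k + m + l, by omega, (hus.trans hst').trans htv⟩
end

section
/- Let G be a bridgeless simple graph of order n with minimum degree δ ≥ 4 and girth g. Then for every real ε > 0, setting L = ⌈(g-1)/ε⌉, the oriented diameter of G satisfies diam→(G) ≤ (2g+ε)·n/(δ+1) + 4·binomial(Lg+1, 2). -/
open SimpleGraph

/-- There is a directed walk with exactly `n` arcs of `O` from `x` to `y`. -/
def StepReach {V : Type*} (O : V → V → Prop) : ℕ → V → V → Prop
  | 0, x, y => x = y
  | n + 1, x, y => ∃ z, O x z ∧ StepReach O n z y

namespace StepReach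

variable {V : Type*} {O O' : V → V → Prop}

theorem trans {m n : ℕ} {x y z : V} (h : StepReach O m x y) (h' : StepReach O n y z) :
    StepReach O (m + n) x z := by
  induction m generalizing x with
  | zero => cases h; simpa using h'
  | succ m ih =>
    obtain ⟨w, hw, h⟩ := h
    rw [Nat.succ_add m n]
    exact ⟨w, hw, ih h⟩

theorem single {x y : V} (h : O x y) : StepReach O 1 x y := ⟨y, h, rfl⟩

theorem mono (hO : ∀ x y, O x y → O' x y) {n : ℕ} {x y : V} (h : StepReach O n x y) :
    StepReach O' n x y := by
  induction n generalizing x with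
  | zero => exact h
  | succ n ih =>
    obtain ⟨w, hw, h⟩ := h
    exact ⟨w, hO _ _ hw, ih h⟩

theorem of_seq (f : ℕ → V) (i n : ℕ) (h : ∀ j, i ≤ j → j < i + n → O (f j) (f (j + 1))) :
    StepReach O n (f i) (f (i + n)) := by
  induction n generalizing i with
  | zero => rfl
  | succ n ih =>
    refine ⟨f (i + 1), h i le_rfl (by omega), ?_⟩
    have := ih (i + 1) fun j h1 h2 => h j (by omega) (by omega)
    rwa [show i + 1 + n = i + (n + 1) by omega] at this

theorem exists_seq {n : ℕ} {x y : V} (h : StepReach O n x y) :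
    ∃ f : ℕ → V, f 0 = x ∧ f n = y ∧ ∀ i < n, O (f i) (f (i + 1)) := by
  induction n generalizing x with
  | zero => exact ⟨fun _ => x, rfl, h, by simp⟩
  | succ n ih =>
    obtain ⟨w, hw, h⟩ := h
    obtain ⟨f, h0, hn, hf⟩ := ih h
    refine ⟨fun i => i.casesOn x f, rfl, hn, ?_⟩
    rintro (_ | i) hi
    · simpa [h0] using hw
    · exact hf i (by omega)

theorem diReach {n : ℕ} {x y : V} (h : StepReach O n x y) :
    ∃ f : Fin (n + 1) → V, f 0 = x ∧ f (Fin.last n) = y ∧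
      ∀ i : Fin n, O (f i.castSucc) (f i.succ) := by
  obtain ⟨f, h0, hn, hf⟩ := h.exists_seq
  exact ⟨fun i => f i, h0, hn, fun i => hf i i.2⟩

/-- A shortest walk from a set `S`: it visits no vertex twice and leaves `S` at once. -/
theorem exists_shortest {S : Set V} {n : ℕ} {x y : V} (hx : x ∈ S) (h : StepReach O n x y) :
    ∃ (m : ℕ) (f : ℕ → V), f 0 ∈ S ∧ f m = y ∧ (∀ i < m, O (f i) (f (i + 1))) ∧
      (∀ i j, i < j → j ≤ m → f i ≠ f j) ∧ ∀ i, 0 < i → i ≤ m → f i ∉ S := by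
  classical
  have hex : ∃ n, ∃ x ∈ S, StepReach O n x y := ⟨n, x, hx, h⟩
  obtain ⟨x', hx', h'⟩ := Nat.find_spec hex
  set m := Nat.find hex with hm
  obtain ⟨f, h0, hn, hf⟩ := h'.exists_seq
  have seg : ∀ i k, i + k ≤ m → StepReach O k (f i) (f (i + k)) := fun i k hik =>
    of_seq f i k fun j _ h2 => hf j (by omega)
  refine ⟨m, f, h0 ▸ hx', hn, hf, fun i j hij hj he => ?_, fun i hi him hiS => ?_⟩
  · have h1 := seg 0 i (by omega)
    have h2 := seg j (m - j) (by omega)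
    rw [show j + (m - j) = m by omega, hn, ← he] at h2
    rw [Nat.zero_add, h0] at h1
    have := Nat.find_min' hex ⟨x', hx', h1.trans h2⟩
    omega
  · have h2 := seg i (m - i) (by omega)
    rw [show i + (m - i) = m by omega, hn] at h2
    have := Nat.find_min' hex ⟨_, hiS, h2⟩
    omega

end StepReach

/-- Enlarging a set on which `O` has diameter at most `d` to a larger strongly connected set
raises the diameter by at most the number of new vertices. -/
theorem exists_stepReach_le_add_card_sdiff {V : Type*} [DecidableEq V] {O O' : V → V → Prop}
    {S S' : Finset V} {d : ℕ}
    (hO : ∀ x y, O x y → O' x y) (hO' : ∀ x y, O' x y → y ∈ S')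
    (hd : ∀ x ∈ S, ∀ y ∈ S, ∃ m ≤ d, StepReach O m x y)
    {x y : V} (hx : x ∈ S') (h : ∃ n, StepReach O' n x y) :
    ∃ m ≤ d + (S' \ S).card, StepReach O' m x y := by
  classical
  set m := Nat.find h with hm
  have h' : StepReach O' m x y := Nat.find_spec h
  have hmin : ∀ k, StepReach O' k x y → m ≤ k := fun k hk => Nat.find_min' h hk
  refine ⟨m, ?_, h'⟩
  obtain ⟨f, h0, hn, hf⟩ := h'.exists_seq
  have seg : ∀ i k, i + k ≤ m → StepReach O' k (f i) (f (i + k)) := fun i k hik =>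
    StepReach.of_seq f i k fun j _ h2 => hf j (by omega)
  have short : ∀ i j k, i ≤ j → j ≤ m → StepReach O' k (f i) (f j) → j - i ≤ k := by
    intro i j k hij hj hk
    have h1 := seg 0 i (by omega)
    have h2 := seg j (m - j) (by omega)
    rw [show j + (m - j) = m by omega, hn] at h2
    rw [Nat.zero_add, h0] at h1
    have := hmin _ ((h1.trans hk).trans h2)
    omega
  have hinj : ∀ i j, i < j → j ≤ m → f i ≠ f j := by
    intro i j hij hj he
    have := short i j 0 hij.le hj he
    omega
  have hmem : ∀ i ≤ m, f i ∈ S' := by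
    rintro (_ | i) hi
    · rwa [h0]
    · exact hO' _ _ (hf i (by omega))
  set I := (Finset.range (m + 1)).filter (fun i => f i ∈ S) with hI
  set J := (Finset.range (m + 1)).filter (fun i => f i ∉ S) with hJ
  have hJc : J.card ≤ (S' \ S).card := by
    apply Finset.card_le_card_of_injOn f
    · intro i hi
      simp only [hJ, Finset.coe_filter, Finset.mem_range, Set.mem_ofPred_eq] at hi
      simpa using ⟨hmem i (by omega), hi.2⟩
    · intro i hi j hj he
      simp only [hJ, Finset.coe_filter, Finset.mem_range, Set.mem_ofPred_eq] at hi hj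
      rcases lt_trichotomy i j with h | h | h
      · exact absurd he (hinj i j h (by omega))
      · exact h
      · exact absurd he.symm (hinj j i h (by omega))
  have hIJ : I.card + J.card = m + 1 := by
    rw [hI, hJ, Finset.card_filter_add_card_filter_not, Finset.card_range]
  rcases I.eq_empty_or_nonempty with hIe | hIn
  · rw [hIe] at hIJ
    simp only [Finset.card_empty] at hIJ
    omega
  · have ha := I.min'_mem hIn
    have hb := I.max'_mem hIn
    set a := I.min' hIn
    set b := I.max' hIn
    have hab : a ≤ b := Finset.min'_le _ _ hb
    have hIc : I ⊆ Finset.Icc a b := fun i hi =>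
      Finset.mem_Icc.2 ⟨Finset.min'_le _ _ hi, Finset.le_max' _ _ hi⟩
    have := Finset.card_le_card hIc
    rw [Nat.card_Icc] at this
    simp only [hI, Finset.mem_filter, Finset.mem_range] at ha hb
    obtain ⟨k, hk, hk'⟩ := hd _ ha.2 _ hb.2
    have := short a b k hab (by omega) (hk'.mono hO)
    omega

/-- In a connected graph the boundary of a nonempty proper set of vertices contains an edge. -/
theorem SimpleGraph.Connected.exists_adj_boundary {V : Type*} {G : SimpleGraph V}
    (hG : G.Connected) (U : Set V) {a b : V} (ha : a ∈ U) (hb : b ∉ U) :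
    ∃ x ∈ U, ∃ y ∉ U, G.Adj x y := by
  obtain ⟨w⟩ := hG.preconnected a b
  obtain ⟨e, -, h1, h2⟩ := w.exists_boundary_dart U ha hb
  exact ⟨_, h1, _, h2, e.adj⟩

/-- If `ab` is not a bridge, then every cut that contains `ab` contains another edge. -/
theorem exists_adj_boundary_ne {V : Type*} {G : SimpleGraph V}
    (hG : ∀ e : Sym2 V, ¬ G.IsBridge e) (U : Set V) {a b : V}
    (ha : a ∈ U) (hb : b ∉ U) :
    ∃ x ∈ U, ∃ y ∉ U, G.Adj x y ∧ ¬ (x = a ∧ y = b) := by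
  have h := hG s(a, b)
  rw [isBridge_iff] at h
  have h : (G.deleteEdges {s(a, b)}).Reachable a b := by
    by_contra hr
    exact h hr
  obtain ⟨w⟩ := h
  obtain ⟨e, -, h1, h2⟩ := w.exists_boundary_dart U ha hb
  have he := e.adj
  rw [deleteEdges_adj] at he
  refine ⟨_, h1, _, h2, he.1, ?_⟩
  rintro ⟨h3, h4⟩
  exact he.2 (by simp [h3, h4])

/-- Breadth-first levels from a set `S` in a connected graph. -/
theorem exists_level {V : Type*} {G : SimpleGraph V} (hG : G.Connected) (S : Finset V)
    (hS : S.Nonempty) :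
    ∃ l : V → ℕ, (∀ x, l x = 0 ↔ x ∈ S) ∧ (∀ x y, G.Adj x y → l y ≤ l x + 1) ∧
      (∀ x, x ∉ S → ∃ y, G.Adj y x ∧ l y + 1 = l x) ∧
      (∀ x, ∃ s ∈ S, StepReach G.Adj (l x) s x) ∧
      ∀ x, ∀ s ∈ S, ∀ n, StepReach G.Adj n s x → l x ≤ n := by
  classical
  have hex : ∀ x, ∃ n, ∃ s ∈ S, StepReach G.Adj n s x := by
    intro x
    obtain ⟨s, hs⟩ := hS
    obtain ⟨w⟩ := hG.preconnected s x
    refine ⟨w.length, s, hs, ?_⟩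
    clear hs
    induction w with
    | nil => rfl
    | cons h p ih => exact ⟨_, h, ih⟩
  have hl : ∀ x, ∃ s ∈ S, StepReach G.Adj (Nat.find (hex x)) s x := fun x => Nat.find_spec (hex x)
  have hmin : ∀ x, ∀ s ∈ S, ∀ n, StepReach G.Adj n s x → Nat.find (hex x) ≤ n :=
    fun x s hs n h => Nat.find_min' (hex x) ⟨s, hs, h⟩
  have h0 : ∀ x, Nat.find (hex x) = 0 ↔ x ∈ S := by
    intro x
    constructor
    · intro h
      obtain ⟨s, hs, h'⟩ := hl x
      rw [h] at h'
      cases h'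
      exact hs
    · intro hx
      exact Nat.le_zero.1 (hmin x x hx 0 rfl)
  have hadj : ∀ x y, G.Adj x y → Nat.find (hex y) ≤ Nat.find (hex x) + 1 := by
    intro x y hxy
    obtain ⟨s, hs, h⟩ := hl x
    exact hmin y s hs _ (h.trans (StepReach.single hxy))
  refine ⟨fun x => Nat.find (hex x), h0, hadj, fun x hx => ?_, hl, hmin⟩
  obtain ⟨s, hs, h⟩ := hl x
  obtain ⟨n, hn⟩ : ∃ n, Nat.find (hex x) = n + 1 :=
    Nat.exists_eq_succ_of_ne_zero fun h => hx ((h0 x).1 h)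
  rw [hn] at h
  obtain ⟨f, hf0, hfn, hf⟩ := h.exists_seq
  have hst := hf n (by omega)
  rw [hfn] at hst
  refine ⟨f n, hst, le_antisymm ?_ (hadj _ _ hst)⟩
  have := hmin (f n) s hs n (by
    have := StepReach.of_seq (O := G.Adj) f 0 n fun j _ h2 => hf j (by omega)
    rwa [hf0, Nat.zero_add] at this)
  show Nat.find (hex (f n)) + 1 ≤ Nat.find (hex x)
  omega

/-- Every symmetric irreflexive relation on a finite type has a two-colouring in which each
related point is related to a point of the other colour. -/
theorem exists_coloring_ne {V : Type*} [Finite V] (B : V → V → Prop)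
    (hs : ∀ a b, B a b → B b a) (hi : ∀ a, ¬ B a a) :
    ∃ c : V → Prop, ∀ a b, B a b → ∃ b', B a b' ∧ (c a ↔ ¬ c b') := by
  classical
  have := Fintype.ofFinite V
  obtain ⟨I, hI, hmax⟩ := Finset.exists_max_image
    (Finset.univ.filter fun I : Finset V => ∀ a ∈ I, ∀ b ∈ I, ¬ B a b) Finset.card
    ⟨∅, by simp⟩
  simp only [Finset.mem_filter, Finset.mem_univ, true_and] at hI hmax
  refine ⟨fun a => a ∈ I, fun a b hab => ?_⟩
  by_cases ha : a ∈ I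
  · exact ⟨b, hab, by simpa [ha] using fun hb => hI a ha b hb hab⟩
  · by_contra hno
    push Not at hno
    have hno' : ∀ b' ∈ I, ¬ B a b' := by
      intro b' hb' hB
      rcases hno b' hB with h | h
      · exact ha h.1
      · exact h.2 hb'
    have := hmax (insert a I) (by
      intro x hx y hy
      rcases Finset.mem_insert.1 hx with hx | hx <;> rcases Finset.mem_insert.1 hy with hy | hy
      · exact hx ▸ hy ▸ hi _
      · exact hx ▸ hno' _ hy
      · exact fun h => hno' _ hx (hy ▸ hs _ _ h)
      · exact hI _ hx _ hy)
    rw [Finset.card_insert_of_notMem ha] at this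
    omega

/-- `O` directs some of the edges of `G` with both ends in `S`, each in at most one direction. -/
structure IsPartialOrientation {V : Type*} (G : SimpleGraph V) (S : Finset V)
    (O : V → V → Prop) : Prop where
  adj : ∀ x y, O x y → G.Adj x y
  asymm : ∀ x y, O x y → ¬ O y x
  left_mem : ∀ x y, O x y → x ∈ S
  right_mem : ∀ x y, O x y → y ∈ S

/-- If every vertex is within distance `r` of `S`, then a partial orientation on `S` extends to a
set containing all neighbours of `S`, such that each of its vertices lies on a directed walk from
`S` to `S` with at most `2 * r + 1` arcs. -/
theorem exists_extension_neighbors {V : Type*} [Fintype V] {G : SimpleGraph V}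
    (hc : G.Connected) (hb : ∀ e : Sym2 V, ¬ G.IsBridge e) {S : Finset V} (hS : S.Nonempty)
    {O : V → V → Prop} (hO : IsPartialOrientation G S O) {r : ℕ}
    (hr : ∀ x, ∃ n ≤ r, ∃ s ∈ S, StepReach G.Adj n s x) :
    ∃ (S' : Finset V) (O' : V → V → Prop), S ⊆ S' ∧ (∀ s ∈ S, ∀ x, G.Adj s x → x ∈ S') ∧
      IsPartialOrientation G S' O' ∧ (∀ x y, O x y → O' x y) ∧
      ∀ x ∈ S', (∃ n ≤ 2 * r, ∃ s ∈ S, StepReach O' n s x) ∧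
        ∃ n ≤ 2 * r, ∃ s ∈ S, StepReach O' n x s := by
  classical
  obtain ⟨l, l0, ladj, lpar, -, lmin⟩ := exists_level hc S hS
  have lr : ∀ x, l x ≤ r := fun x => by
    obtain ⟨n, hn, s, hs, h⟩ := hr x
    exact (lmin x s hs n h).trans hn
  choose! par hpar using lpar
  set root : V → V := fun x => par^[l x - 1] x with hroot
  have root_one : ∀ x, l x = 1 → root x = x := fun x hx => by simp [hroot, hx]
  have root_par : ∀ x, x ∉ S → par x ∉ S → root (par x) = root x := by
    intro x hx hp
    have h1 := (hpar x hx).2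
    have h2 : l (par x) ≠ 0 := fun h => hp ((l0 _).1 h)
    obtain ⟨k, hk⟩ := Nat.exists_eq_succ_of_ne_zero h2
    have h3 : l x = k + 2 := by omega
    simp [hroot, hk, h3, Function.iterate_succ_apply]
  have l_pos : ∀ x, x ∉ S → 1 ≤ l x := fun x hx =>
    Nat.one_le_iff_ne_zero.2 fun h => hx ((l0 x).1 h)
  obtain ⟨col, hcol⟩ := exists_coloring_ne
    (fun w w' => w ≠ w' ∧ ∃ x y, x ∉ S ∧ y ∉ S ∧ root x = w ∧ root y = w' ∧ G.Adj x y)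
    (fun a b ⟨h, x, y, hx, hy, h1, h2, h3⟩ => ⟨h.symm, y, x, hy, hx, h2, h1, h3.symm⟩)
    (fun a h => h.1 rfl)
  set Q : V → V → Prop := fun x y =>
    O x y ∨ (y ∉ S ∧ x = par y ∧ col (root y)) ∨ (x ∉ S ∧ y = par x ∧ ¬ col (root x)) ∨
    (x ∉ S ∧ y ∉ S ∧ root x ≠ root y ∧ col (root x) ∧ ¬ col (root y) ∧ G.Adj x y) ∨
    (x ∉ S ∧ y ∈ S ∧ y ≠ par x ∧ col (root x) ∧ G.Adj x y) ∨
    (x ∈ S ∧ y ∉ S ∧ x ≠ par y ∧ ¬ col (root y) ∧ G.Adj x y) with hQ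
  have Q_adj : ∀ x y, Q x y → G.Adj x y := by
    rintro x y (h | ⟨h, rfl, -⟩ | ⟨h, rfl, -⟩ | h | h | h)
    · exact hO.adj _ _ h
    · exact (hpar y h).1
    · exact (hpar x h).1.symm
    · exact h.2.2.2.2.2
    · exact h.2.2.2.2
    · exact h.2.2.2.2
  have Q_asymm : ∀ x y, Q x y → ¬ Q y x := by
    intro x y h1 h2
    have a1 := hO.asymm x y
    have a2 := hO.left_mem x y
    have a3 := hO.right_mem x y
    have a4 := hO.left_mem y x
    have a5 := hO.right_mem y x
    have b1 := hpar x
    have b2 := hpar y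
    have c1 := root_par x
    have c2 := root_par y
    clear_value root Q
    subst hQ
    grind
  have down : ∀ n x, l x = n + 1 → col (root x) →
      ∃ s ∈ S, StepReach Q 1 s (root x) ∧ StepReach Q n (root x) x := by
    intro n
    induction n with
    | zero =>
      intro x hx hcx
      have hxS : x ∉ S := fun h => by rw [(l0 x).2 h] at hx; omega
      have hp := hpar x hxS
      have h1 := root_one x hx
      refine ⟨par x, (l0 _).1 (by omega), StepReach.single ?_, h1⟩
      rw [h1] at hcx ⊢
      exact Or.inr (Or.inl ⟨hxS, rfl, by rwa [h1]⟩)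
    | succ n ih =>
      intro x hx hcx
      have hxS : x ∉ S := fun h => by rw [(l0 x).2 h] at hx; omega
      have hp := hpar x hxS
      have hpS : par x ∉ S := fun h => by have := (l0 _).2 h; omega
      have h1 := root_par x hxS hpS
      obtain ⟨s, hs, h2, h3⟩ := ih (par x) (by omega) (by rwa [h1])
      rw [h1] at h2 h3
      exact ⟨s, hs, h2, h3.trans (StepReach.single (Or.inr (Or.inl ⟨hxS, rfl, hcx⟩)))⟩
  have up : ∀ n x, l x = n + 1 → ¬ col (root x) →
      ∃ s ∈ S, StepReach Q n x (root x) ∧ StepReach Q 1 (root x) s := by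
    intro n
    induction n with
    | zero =>
      intro x hx hcx
      have hxS : x ∉ S := fun h => by rw [(l0 x).2 h] at hx; omega
      have hp := hpar x hxS
      have h1 := root_one x hx
      refine ⟨par x, (l0 _).1 (by omega), h1.symm, StepReach.single ?_⟩
      rw [h1] at hcx ⊢
      exact Or.inr (Or.inr (Or.inl ⟨hxS, rfl, by rwa [h1]⟩))
    | succ n ih =>
      intro x hx hcx
      have hxS : x ∉ S := fun h => by rw [(l0 x).2 h] at hx; omega
      have hp := hpar x hxS
      have hpS : par x ∉ S := fun h => by have := (l0 _).2 h; omega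
      have h1 := root_par x hxS hpS
      obtain ⟨s, hs, h2, h3⟩ := ih (par x) (by omega) (by rwa [h1])
      rw [h1] at h2 h3
      refine ⟨s, hs, ?_, h3⟩
      have := (StepReach.single (O := Q)
        (Or.inr (Or.inr (Or.inl ⟨hxS, rfl, hcx⟩)) : Q x (par x))).trans h2
      rwa [Nat.add_comm] at this
  set Ear : V → Prop := fun x => ∃ a b, a + b ≤ 2 * r + 1 ∧
    ∃ s ∈ S, ∃ t ∈ S, StepReach Q a s x ∧ StepReach Q b x t with hEar
  have cross : ∀ x y, x ∉ S → y ∉ S → root x ≠ root y → col (root x) → ¬ col (root y) →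
      G.Adj x y → Ear (root x) ∧ Ear (root y) := by
    intro x y hx hy hne hcx hcy hxy
    obtain ⟨n, hn⟩ := Nat.exists_eq_succ_of_ne_zero (Nat.one_le_iff_ne_zero.1 (l_pos x hx))
    obtain ⟨k, hk⟩ := Nat.exists_eq_succ_of_ne_zero (Nat.one_le_iff_ne_zero.1 (l_pos y hy))
    obtain ⟨s, hs, h1, h2⟩ := down n x hn hcx
    obtain ⟨t, ht, h3, h4⟩ := up k y hk hcy
    have h5 := StepReach.single (O := Q)
      (Or.inr (Or.inr (Or.inr (Or.inl ⟨hx, hy, hne, hcx, hcy, hxy⟩))) : Q x y)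
    have := lr x
    have := lr y
    exact ⟨⟨1, n + 1 + k + 1, by omega, s, hs, t, ht, h1, ((h2.trans h5).trans h3).trans h4⟩,
      ⟨1 + n + 1 + k, 1, by omega, s, hs, t, ht, ((h1.trans h2).trans h5).trans h3, h4⟩⟩
  have ear_one : ∀ w, l w = 1 → Ear w := by
    intro w hw
    have hwS : w ∉ S := fun h => by rw [(l0 w).2 h] at hw; omega
    have hrw := root_one w hw
    have hpw := hpar w hwS
    obtain ⟨x, ⟨hx, hxw⟩, y, hy, hxy, hne⟩ := exists_adj_boundary_ne hb
      {x | x ∉ S ∧ root x = w} (a := w) (b := par w) ⟨hwS, hrw⟩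
      (fun h => h.1 ((l0 _).1 (by omega)))
    by_cases hyS : y ∈ S
    · have hyp : y ≠ par x := by
        rintro rfl
        have h0 := (l0 _).2 hyS
        have h1 := (hpar x hx).2
        have h2 := root_one x (by omega)
        have h3 : x = w := h2.symm.trans hxw
        exact hne ⟨h3, by rw [h3]⟩
      obtain ⟨n, hn⟩ := Nat.exists_eq_succ_of_ne_zero (Nat.one_le_iff_ne_zero.1 (l_pos x hx))
      have := lr x
      by_cases hcx : col (root x)
      · obtain ⟨s, hs, h1, h2⟩ := down n x hn hcx
        have h5 := StepReach.single (O := Q)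
          (Or.inr (Or.inr (Or.inr (Or.inr (Or.inl ⟨hx, hyS, hyp, hcx, hxy⟩)))) : Q x y)
        rw [← hxw]
        exact ⟨1, n + 1, by omega, s, hs, y, hyS, h1, h2.trans h5⟩
      · obtain ⟨s, hs, h1, h2⟩ := up n x hn hcx
        have h5 := StepReach.single (O := Q)
          (Or.inr (Or.inr (Or.inr (Or.inr (Or.inr ⟨hyS, hx, hyp, hcx, hxy.symm⟩)))) : Q y x)
        rw [← hxw]
        exact ⟨1 + n, 1, by omega, y, hyS, s, hs, h5.trans h1, h2⟩
    · obtain ⟨w', ⟨hne', x', y', hx', hy', hrx', hry', hxy'⟩, hc'⟩ := hcol w (root y)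
        ⟨fun h => hy ⟨hyS, h.symm⟩, x, y, hx, hyS, hxw, rfl, hxy⟩
      by_cases hcw : col w
      · have := (cross x' y' hx' hy' (by rwa [hrx', hry']) (by rwa [hrx'])
          (by rw [hry']; exact hc'.1 hcw) hxy').1
        rwa [hrx'] at this
      · have := (cross y' x' hy' hx' (by rw [hrx', hry']; exact hne'.symm)
          (by rw [hry']; by_contra h; exact hcw (hc'.2 h)) (by rwa [hrx']) hxy'.symm).2
        rwa [hrx'] at this
  set S' : Finset V := Finset.univ.filter fun x => x ∈ S ∨ Ear x with hS'
  have memS' : ∀ x, x ∈ S' ↔ x ∈ S ∨ Ear x := fun x => by simp [hS']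
  have ear_mem : ∀ x a b, a + b ≤ 2 * r + 1 → (∃ s ∈ S, StepReach Q a s x) →
      (∃ t ∈ S, StepReach Q b x t) → x ∈ S' := by
    rintro x a b h ⟨s, hs, h1⟩ ⟨t, ht, h2⟩
    exact (memS' x).2 (Or.inr ⟨a, b, h, s, hs, t, ht, h1, h2⟩)
  set O' : V → V → Prop := fun x y => Q x y ∧ x ∈ S' ∧ y ∈ S' with hO'
  have restrict : ∀ n x y a b, a + n + b ≤ 2 * r + 1 → (∃ s ∈ S, StepReach Q a s x) →
      StepReach Q n x y → (∃ t ∈ S, StepReach Q b y t) → StepReach O' n x y := by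
    intro n
    induction n with
    | zero => exact fun x y a b _ _ h _ => h
    | succ n ih =>
      rintro x y a b hab ⟨s, hs, hsx⟩ ⟨z, hxz, hzy⟩ ⟨t, ht, hyt⟩
      have hz : StepReach Q (a + 1) s z := hsx.trans (StepReach.single hxz)
      have hzt : StepReach Q (n + b) z t := hzy.trans hyt
      refine ⟨z, ⟨hxz, ?_, ?_⟩, ih z y (a + 1) b (by omega) ⟨s, hs, hz⟩ hzy ⟨t, ht, hyt⟩⟩
      · exact ear_mem x a (1 + (n + b)) (by omega) ⟨s, hs, hsx⟩
          ⟨t, ht, (StepReach.single hxz).trans hzt⟩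
      · exact ear_mem z (a + 1) (n + b) (by omega) ⟨s, hs, hz⟩ ⟨t, ht, hzt⟩
  refine ⟨S', O', fun x hx => (memS' x).2 (Or.inl hx), fun s hs x hsx => ?_,
    ⟨fun x y h => Q_adj x y h.1, fun x y h h' => Q_asymm x y h.1 h'.1, fun x y h => h.2.1,
      fun x y h => h.2.2⟩, fun x y h => ⟨Or.inl h, (memS' x).2 (Or.inl (hO.left_mem x y h)),
      (memS' y).2 (Or.inl (hO.right_mem x y h))⟩, fun x hx => ?_⟩
  · by_cases hx : x ∈ S
    · exact (memS' x).2 (Or.inl hx)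
    · have h1 := ladj s x hsx
      have h2 := (l0 s).2 hs
      have h3 := l_pos x hx
      exact (memS' x).2 (Or.inr (ear_one x (by omega)))
  · by_cases hxS : x ∈ S
    · exact ⟨⟨0, by omega, x, hxS, rfl⟩, 0, by omega, x, hxS, rfl⟩
    · rcases (memS' x).1 hx with h | ⟨a, b, hab, s, hs, t, ht, h1, h2⟩
      · exact absurd h hxS
      · have ha : a ≠ 0 := by rintro rfl; cases h1; exact hxS hs
        have hb : b ≠ 0 := by rintro rfl; cases h2; exact hxS ht
        exact ⟨⟨a, by omega, s, hs, restrict a s x 0 b (by omega) ⟨s, hs, rfl⟩ h1 ⟨t, ht, h2⟩⟩,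
          b, by omega, t, ht, restrict b x t a 0 (by omega) ⟨s, hs, h1⟩ h2 ⟨t, ht, rfl⟩⟩

/-- The Chvátal–Thomassen bound relative to an already oriented set `S`. -/
theorem exists_extension_univ {V : Type*} [Fintype V] {G : SimpleGraph V}
    (hc : G.Connected) (hb : ∀ e : Sym2 V, ¬ G.IsBridge e) (r : ℕ) {S : Finset V}
    (hS : S.Nonempty) {O : V → V → Prop} (hO : IsPartialOrientation G S O)
    (hr : ∀ x, ∃ n ≤ r, ∃ s ∈ S, StepReach G.Adj n s x) :
    ∃ O' : V → V → Prop, IsPartialOrientation G Finset.univ O' ∧ (∀ x y, O x y → O' x y) ∧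
      ∀ x, (∃ n ≤ r ^ 2 + r, ∃ s ∈ S, StepReach O' n s x) ∧
        ∃ n ≤ r ^ 2 + r, ∃ s ∈ S, StepReach O' n x s := by
  induction r generalizing S O with
  | zero =>
    refine ⟨O, ⟨hO.adj, hO.asymm, by simp, by simp⟩, fun _ _ h => h, fun x => ?_⟩
    obtain ⟨n, hn, s, hs, h⟩ := hr x
    obtain rfl : n = 0 := by omega
    cases h
    exact ⟨⟨0, by simp, x, hs, rfl⟩, 0, by simp, x, hs, rfl⟩
  | succ r ih =>
    obtain ⟨S', O₁, hSS', hN, hO₁, hOO₁, h₁⟩ := exists_extension_neighbors hc hb hS hO hr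
    obtain ⟨O', hO', hO₁O', h'⟩ := ih (hS.mono hSS') hO₁ (by
      intro x
      obtain ⟨n, hn, s, hs, h⟩ := hr x
      cases n with
      | zero => exact ⟨0, by omega, s, hSS' hs, h⟩
      | succ n =>
        obtain ⟨z, hz, h⟩ := h
        exact ⟨n, by omega, z, hN s hs z hz, h⟩)
    refine ⟨O', hO', fun x y h => hO₁O' x y (hOO₁ x y h), fun x => ?_⟩
    have hle : (r + 1) ^ 2 + (r + 1) = 2 * (r + 1) + (r ^ 2 + r) := by ring
    rw [hle]
    obtain ⟨⟨n, hn, s, hs, h1⟩, m, hm, t, ht, h2⟩ := h' x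
    obtain ⟨n', hn', s', hs', h3⟩ := (h₁ s hs).1
    obtain ⟨m', hm', t', ht', h4⟩ := (h₁ t ht).2
    exact ⟨⟨n' + n, by omega, s', hs', (h3.mono hO₁O').trans h1⟩,
      m + m', by omega, t', ht', h2.trans (h4.mono hO₁O')⟩

/-- A partial orientation extends to an orientation. -/
theorem IsPartialOrientation.exists_isOrientation {V : Type*} {G : SimpleGraph V}
    {S : Finset V} {O : V → V → Prop} (hO : IsPartialOrientation G S O) :
    ∃ D : V → V → Prop, ((∀ u v, D u v → G.Adj u v) ∧ ∀ u v, G.Adj u v → (D u v ↔ ¬ D v u)) ∧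
      ∀ u v, O u v → D u v := by
  classical
  let _ : LinearOrder V := WellOrderingRel.isWellOrder.linearOrder
  refine ⟨fun x y => O x y ∨ (G.Adj x y ∧ ¬ O y x ∧ x < y), ⟨?_, ?_⟩, fun u v h => Or.inl h⟩
  · rintro u v (h | h)
    · exact hO.adj _ _ h
    · exact h.1
  · intro u v h
    have h1 := hO.asymm u v
    have h2 := hO.asymm v u
    have h3 := h.symm
    rcases lt_trichotomy u v with h4 | h4 | h4
    · have h5 := h4.asymm
      tauto
    · exact absurd h4 h.ne
    · have h5 := h4.asymm
      tauto

/-- The arcs of the path `p 0, …, p D`. -/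
def PathArc {V : Type*} (p : ℕ → V) (D : ℕ) (x y : V) : Prop :=
  ∃ a < D, p a = x ∧ p (a + 1) = y

/-- Potentials that vanish on `S`, grow by at most one along each edge off the path
`p 0, …, p D` and strictly increase along the path. These are the feasible dual solutions of
the minimum-cost flow problem that sends two units of flow from `S` to `p D`. -/
structure IsPathPotential {V : Type*} (G : SimpleGraph V) (S : Finset V) (p : ℕ → V) (D : ℕ)
    (π : V → ℕ) : Prop where
  zero : ∀ x ∈ S, π x = 0
  adj : ∀ x y, G.Adj x y → ¬ PathArc p D x y → ¬ PathArc p D y x → π y ≤ π x + 1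
  step : ∀ a < D, π (p a) + 1 ≤ π (p (a + 1))

/-- The tight arcs of the residual network. -/
def TightArc {V : Type*} (G : SimpleGraph V) (p : ℕ → V) (D : ℕ) (π : V → ℕ) (x y : V) : Prop :=
  (G.Adj x y ∧ ¬ PathArc p D x y ∧ ¬ PathArc p D y x ∧ π y = π x + 1) ∨
    (PathArc p D y x ∧ π x = π y + 1)

namespace IsPathPotential

variable {V : Type*} {G : SimpleGraph V} {S : Finset V} {p : ℕ → V} {D : ℕ} {π : V → ℕ}

theorem add_le (h : IsPathPotential G S p D π) {i j : ℕ} (hij : i ≤ j) (hj : j ≤ D) :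
    π (p i) + (j - i) ≤ π (p j) := by
  induction j, hij using Nat.le_induction with
  | base => simp
  | succ j hij ih =>
    have := ih (by omega)
    have := h.step j (by omega)
    omega

theorem exists_eq_of_le (h : IsPathPotential G S p D π) (hc : G.Connected)
    (hb : ∀ e : Sym2 V, ¬ G.IsBridge e) (hp : p 0 ∈ S) {x : V} {k : ℕ} (hk : k ≤ π x) :
    ∃ y, π y = k := by
  by_contra! hne
  have h0 : 0 < k := by
    rcases Nat.eq_zero_or_pos k with rfl | h0
    · exact absurd (h.zero _ hp) (hne _)
    · exact h0
  have key : ∀ a b, k ≤ π a → ¬ k ≤ π b → G.Adj a b → ∃ i < D, p i = b ∧ p (i + 1) = a := by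
    intro a b ha hb' hab
    have h1 := hne a
    have h2 : ¬ PathArc p D a b := by
      rintro ⟨i, hi, rfl, rfl⟩
      have := h.step i hi
      omega
    by_contra h3
    have := h.adj b a hab.symm h3 h2
    omega
  obtain ⟨a, ha, b, hb', hab⟩ := hc.exists_adj_boundary {y | k ≤ π y} (a := x) (b := p 0) hk
    (by simp [h.zero _ hp]; omega)
  obtain ⟨i, hi, rfl, rfl⟩ := key a b ha hb' hab
  obtain ⟨a', ha', b', hb'', hab', hne'⟩ := exists_adj_boundary_ne hb {y | k ≤ π y} ha hb'
  obtain ⟨j, hj, rfl, rfl⟩ := key a' b' ha' hb'' hab'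
  simp only [Set.mem_ofPred_eq] at ha hb' ha' hb''
  rcases lt_trichotomy i j with hij | rfl | hij
  · have := h.add_le (i := i + 1) (j := j) hij (by omega)
    omega
  · exact hne' ⟨rfl, rfl⟩
  · have := h.add_le (i := j + 1) (j := i) hij (by omega)
    omega

theorem lt_card [Fintype V] (h : IsPathPotential G S p D π) (hc : G.Connected)
    (hb : ∀ e : Sym2 V, ¬ G.IsBridge e) (hp : p 0 ∈ S) (x : V) : π x < Fintype.card V := by
  classical
  have h1 : Finset.range (π x + 1) ⊆ Finset.univ.image π := by
    intro k hk
    obtain ⟨y, hy⟩ := h.exists_eq_of_le hc hb hp (x := x) (k := k)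
      (by simpa [Nat.lt_succ_iff] using hk)
    exact Finset.mem_image.2 ⟨y, Finset.mem_univ _, hy⟩
  have h2 := Finset.card_le_card h1
  have h3 : (Finset.univ.image π).card ≤ Fintype.card V := Finset.card_image_le
  simp only [Finset.card_range] at h2
  omega

end IsPathPotential

/-- Complementary slackness: a maximal potential reaches every vertex by tight arcs. -/
theorem exists_isPathPotential {V : Type*} [Fintype V] {G : SimpleGraph V} {S : Finset V}
    {p : ℕ → V} {D : ℕ} {π₀ : V → ℕ} (h₀ : IsPathPotential G S p D π₀) (hc : G.Connected)
    (hb : ∀ e : Sym2 V, ¬ G.IsBridge e) (hp : p 0 ∈ S) :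
    ∃ π, IsPathPotential G S p D π ∧ ∀ x, ∃ s ∈ S, ∃ n, StepReach (TightArc G p D π) n s x := by
  classical
  let T : Set ℕ := {t | ∃ π, IsPathPotential G S p D π ∧ ∑ x, π x = t}
  have hT : BddAbove T := by
    refine ⟨∑ _x : V, Fintype.card V, ?_⟩
    rintro t ⟨π, hπ, rfl⟩
    exact Finset.sum_le_sum fun x _ => (hπ.lt_card hc hb hp x).le
  obtain ⟨π, hπ, hs⟩ := Nat.sSup_mem (s := T) ⟨_, π₀, h₀, rfl⟩ hT
  refine ⟨π, hπ, ?_⟩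
  by_contra! hx
  obtain ⟨x₀, hx₀⟩ := hx
  let W : Set V := {x | ∀ s ∈ S, ∀ n, ¬ StepReach (TightArc G p D π) n s x}
  have hW : ∀ x y, x ∉ W → y ∈ W → ¬ TightArc G p D π x y := by
    intro x y hx hy hxy
    simp only [W, Set.mem_ofPred_eq, not_forall, not_not] at hx hy
    obtain ⟨s, hs, n, hn⟩ := hx
    exact hy s hs (n + 1) (hn.trans (StepReach.single hxy))
  let π' : V → ℕ := fun x => if x ∈ W then π x + 1 else π x
  have hπ' : IsPathPotential G S p D π' := by
    refine ⟨?_, ?_, ?_⟩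
    · intro x hx
      have : x ∉ W := fun h => h x hx 0 rfl
      simp [π', this, hπ.zero x hx]
    · intro x y hxy h1 h2
      have h3 := hπ.adj x y hxy h1 h2
      by_cases hx : x ∈ W <;> by_cases hy : y ∈ W <;> simp only [π', hx, hy, if_true, if_false]
      · omega
      · omega
      · have h4 : ¬ π y = π x + 1 := fun h => hW x y hx hy (Or.inl ⟨hxy, h1, h2, h⟩)
        omega
      · exact h3
    · intro a ha
      have h3 := hπ.step a ha
      by_cases hx : p a ∈ W <;> by_cases hy : p (a + 1) ∈ W <;>
        simp only [π', hx, hy, if_true, if_false]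
      · omega
      · have h4 : ¬ π (p (a + 1)) = π (p a) + 1 :=
          fun h => hW _ _ hy hx (Or.inr ⟨⟨a, ha, rfl, rfl⟩, h⟩)
        omega
      · omega
      · exact h3
  have h1 : ∑ x, π x < ∑ x, π' x := by
    refine Finset.sum_lt_sum (fun x _ => ?_) ⟨x₀, Finset.mem_univ _, ?_⟩
    · simp only [π']; split_ifs <;> omega
    · have : x₀ ∈ W := hx₀
      simp [π', this]
  have h2 : ∑ x, π' x ≤ sSup T := le_csSup hT ⟨π', hπ', rfl⟩
  omega

theorem lt_of_forall_lt_succ {V : Type*} {f : ℕ → V} {π : V → ℕ} {n : ℕ} (h : ∀ i < n, π (f i) < π (f (i + 1)))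
    {i j : ℕ} (hij : i < j) (hj : j ≤ n) : π (f i) < π (f j) := by
  induction j, hij using Nat.le_induction with
  | base => exact h i (by omega)
  | succ j hij ih => exact (ih (by omega)).trans (h j (by omega))

section ArcSets

variable {V : Type*} [DecidableEq V]

/-- Out-degree minus in-degree of `x` in the set `A` of arcs. -/
def excess (A : Finset (V × V)) (x : V) : ℤ :=
  ∑ e ∈ A, ((if e.1 = x then 1 else 0) - (if e.2 = x then 1 else 0))

/-- The set of arcs of the walk `f 0, …, f n`. -/
def walkArcs (f : ℕ → V) (n : ℕ) : Finset (V × V) :=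
  (Finset.range n).image fun i => (f i, f (i + 1))

theorem mem_walkArcs {f : ℕ → V} {n : ℕ} {x y : V} :
    (x, y) ∈ walkArcs f n ↔ ∃ i < n, f i = x ∧ f (i + 1) = y := by
  simp [walkArcs]

theorem sum_walkArcs {f : ℕ → V} {n : ℕ} (hf : ∀ i j, i < j → j ≤ n → f i ≠ f j)
    (w : V × V → ℤ) : ∑ e ∈ walkArcs f n, w e = ∑ i ∈ Finset.range n, w (f i, f (i + 1)) := by
  refine Finset.sum_image fun i hi j hj hij => ?_
  simp only [Finset.coe_range, Set.mem_Iio] at hi hj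
  simp only [Prod.mk.injEq] at hij
  rcases lt_trichotomy i j with h | h | h
  · exact absurd hij.1 (hf i j h hj.le)
  · exact h
  · exact absurd hij.1.symm (hf j i h hi.le)

theorem card_walkArcs {f : ℕ → V} {n : ℕ} (hf : ∀ i j, i < j → j ≤ n → f i ≠ f j) :
    (walkArcs f n).card = n := by
  have := sum_walkArcs hf (fun _ => 1)
  simpa using this

theorem excess_walkArcs {f : ℕ → V} {n : ℕ} (hf : ∀ i j, i < j → j ≤ n → f i ≠ f j) (x : V) :
    excess (walkArcs f n) x = (if f 0 = x then 1 else 0) - (if f n = x then 1 else 0) := by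
  rw [excess, sum_walkArcs hf]
  exact Finset.sum_range_sub' (fun i => if f i = x then (1 : ℤ) else 0) n

theorem excess_sdiff {A B : Finset (V × V)} (h : B ⊆ A) (x : V) :
    excess (A \ B) x = excess A x - excess B x := by
  rw [excess, excess, excess, ← Finset.sum_sdiff h]
  ring

theorem excess_image_swap (A : Finset (V × V)) (x : V) :
    excess (A.image Prod.swap) x = - excess A x := by
  rw [excess, Finset.sum_image (fun _ _ _ _ h => Prod.swap_injective h), excess,
    ← Finset.sum_neg_distrib]
  exact Finset.sum_congr rfl fun e _ => by simp

theorem exists_mem_of_excess_pos {A : Finset (V × V)} {x : V} (h : 0 < excess A x) :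
    ∃ e ∈ A, e.1 = x := by
  by_contra! hne
  refine absurd h (not_lt.2 (Finset.sum_nonpos fun e he => ?_))
  rw [if_neg (hne e he)]
  split_ifs <;> simp

/-- In an acyclic set of arcs in which only `v` has a deficit, one can walk to `v`. -/
theorem exists_walk_of_excess_nonneg {A : Finset (V × V)} {π : V → ℕ} {v : V}
    (hπ : ∀ e ∈ A, π e.1 < π e.2) (hA : ∀ x, x ≠ v → 0 ≤ excess A x) {x : V}
    (hx : x = v ∨ ∃ e ∈ A, e.1 = x) :
    ∃ (n : ℕ) (f : ℕ → V), f 0 = x ∧ f n = v ∧ ∀ i < n, (f i, f (i + 1)) ∈ A := by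
  suffices h : ∃ n, StepReach (fun x y => (x, y) ∈ A) n x v by
    obtain ⟨n, h⟩ := h
    obtain ⟨f, hf⟩ := h.exists_seq
    exact ⟨n, f, hf⟩
  obtain ⟨B, hB⟩ : ∃ B, ∀ e ∈ A, π e.2 ≤ B := ⟨A.sup fun e => π e.2, fun e he =>
    Finset.le_sup (f := fun e : V × V => π e.2) he⟩
  induction hd : B - π x using Nat.strong_induction_on generalizing x with
  | _ d ih =>
    by_cases hxv : x = v
    · exact ⟨0, hxv⟩
    obtain ⟨e, he, rfl⟩ := hx.resolve_left hxv
    have h1 := hπ e he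
    have h2 := hB e he
    obtain ⟨n, hn⟩ := ih (B - π e.2) (by omega) (x := e.2) (by
      by_cases hv : e.2 = v
      · exact Or.inl hv
      refine Or.inr ?_
      by_contra! hne
      refine absurd (hA _ hv) (not_le.2 (Finset.sum_neg' (fun i hi => ?_) ⟨e, he, ?_⟩))
      · rw [if_neg (hne i hi)]
        split_ifs <;> simp
      · rw [if_neg (hne e he)]
        simp) rfl
    exact ⟨n + 1, e.2, he, hn⟩

/-- Two arc-disjoint walks to `v` decompose a flow of value two. -/
theorem exists_two_walks {A : Finset (V × V)} {π : V → ℕ} {v s t : V}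
    (hπ : ∀ e ∈ A, π e.1 < π e.2) (hs : s ≠ v) (ht : t ≠ v)
    (hA : ∀ x, excess A x = (if s = x then 1 else 0) + (if t = x then 1 else 0)
      - 2 * (if v = x then 1 else 0)) :
    ∃ (n₁ : ℕ) (f₁ : ℕ → V) (n₂ : ℕ) (f₂ : ℕ → V), f₁ 0 = s ∧ f₁ n₁ = v ∧ f₂ 0 = t ∧ f₂ n₂ = v ∧
      (∀ i < n₁, (f₁ i, f₁ (i + 1)) ∈ A) ∧ (∀ i < n₂, (f₂ i, f₂ (i + 1)) ∈ A) ∧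
      (∀ i < n₁, ∀ j < n₂, ¬ (f₁ i = f₂ j ∧ f₁ (i + 1) = f₂ (j + 1))) ∧ n₁ + n₂ ≤ A.card := by
  have inj : ∀ (n : ℕ) (f : ℕ → V), (∀ i < n, (f i, f (i + 1)) ∈ A) →
      ∀ i j, i < j → j ≤ n → f i ≠ f j := by
    intro n f hf i j hij hj he
    have := lt_of_forall_lt_succ (π := π) (fun i hi => hπ _ (hf i hi)) hij hj
    rw [he] at this
    exact lt_irrefl _ this
  obtain ⟨n₁, f₁, h0, hn, hf⟩ := exists_walk_of_excess_nonneg hπ (x := s) (v := v)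
    (fun x hx => by rw [hA, if_neg hx.symm]; split_ifs <;> simp)
    (Or.inr (exists_mem_of_excess_pos (by
      rw [hA, if_neg hs.symm, if_pos rfl]; split_ifs <;> simp)))
  have hsub : walkArcs f₁ n₁ ⊆ A := by
    rintro ⟨x, y⟩ he
    obtain ⟨i, hi, rfl, rfl⟩ := mem_walkArcs.1 he
    exact hf i hi
  have hA' : ∀ x, excess (A \ walkArcs f₁ n₁) x =
      (if t = x then 1 else 0) - (if v = x then 1 else 0) := by
    intro x
    rw [excess_sdiff hsub, hA, excess_walkArcs (inj _ _ hf), h0, hn]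
    ring
  obtain ⟨n₂, f₂, h0', hn', hf'⟩ := exists_walk_of_excess_nonneg (A := A \ walkArcs f₁ n₁)
    (fun e he => hπ e (Finset.mem_sdiff.1 he).1) (x := t) (v := v)
    (fun x hx => by rw [hA', if_neg hx.symm]; split_ifs <;> simp)
    (Or.inr (exists_mem_of_excess_pos (by
      rw [hA', if_neg ht.symm, if_pos rfl]; simp)))
  have hf'' : ∀ i < n₂, (f₂ i, f₂ (i + 1)) ∈ A := fun i hi => (Finset.mem_sdiff.1 (hf' i hi)).1
  refine ⟨n₁, f₁, n₂, f₂, h0, hn, h0', hn', hf, hf'', ?_, ?_⟩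
  · rintro i hi j hj ⟨h1, h2⟩
    exact (Finset.mem_sdiff.1 (hf' j hj)).2 (mem_walkArcs.2 ⟨i, hi, h1, h2⟩)
  · have h1 : walkArcs f₂ n₂ ⊆ A \ walkArcs f₁ n₁ := by
      rintro ⟨x, y⟩ he
      obtain ⟨i, hi, rfl, rfl⟩ := mem_walkArcs.1 he
      exact hf' i hi
    have h2 := Finset.card_le_card h1
    rw [Finset.card_sdiff_of_subset hsub, card_walkArcs (inj _ _ hf''),
      card_walkArcs (inj _ _ hf)] at h2
    have h3 := Finset.card_le_card hsub
    rw [card_walkArcs (inj _ _ hf)] at h3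
    omega

end ArcSets

/-- The arcs that may be used by the two new paths. -/
def AscentArc {V : Type*} (G : SimpleGraph V) (p : ℕ → V) (D : ℕ) (π : V → ℕ) (x y : V) : Prop :=
  G.Adj x y ∧ π x < π y ∧ (PathArc p D x y ∨ π y = π x + 1)

theorem IsPathPotential.exists_two_paths {V : Type*} {G : SimpleGraph V}
    {S : Finset V} {p : ℕ → V} {D : ℕ} {π : V → ℕ} (h : IsPathPotential G S p D π)
    (hp : ∀ a < D, G.Adj (p a) (p (a + 1))) (hD : 0 < D) (hp0 : p 0 ∈ S)
    (ht : ∃ s ∈ S, ∃ n, StepReach (TightArc G p D π) n s (p D)) :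
    ∃ (n₁ : ℕ) (f₁ : ℕ → V) (n₂ : ℕ) (f₂ : ℕ → V), f₁ 0 ∈ S ∧ f₁ n₁ = p D ∧ f₂ 0 ∈ S ∧
      f₂ n₂ = p D ∧
      (∀ i < n₁, AscentArc G p D π (f₁ i) (f₁ (i + 1))) ∧
      (∀ i < n₂, AscentArc G p D π (f₂ i) (f₂ (i + 1))) ∧
      (∀ i < n₁, ∀ j < n₂, ¬ (f₁ i = f₂ j ∧ f₁ (i + 1) = f₂ (j + 1))) ∧
      n₁ + n₂ ≤ D + π (p D) := by
  classical
  obtain ⟨s, hs, n, hn⟩ := ht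
  obtain ⟨m, q, hq0, hqm, hq, hqi, -⟩ := StepReach.exists_shortest (S := (S : Set V)) hs hn
  have hpi : ∀ i j, i < j → j ≤ D → p i ≠ p j := by
    intro i j hij hj he
    have := h.add_le hij.le hj
    rw [he] at this
    omega
  have hpos : 0 < π (p D) := by
    have := h.add_le (Nat.zero_le D) le_rfl
    omega
  have hne : ∀ s ∈ S, s ≠ p D := by
    rintro s hs rfl
    rw [h.zero _ hs] at hpos
    omega
  set P := walkArcs p D with hP
  set Q := walkArcs q m with hQ
  have memP : ∀ x y, (x, y) ∈ P ↔ PathArc p D x y := fun x y => mem_walkArcs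
  have hQt : ∀ x y, (x, y) ∈ Q → TightArc G p D π x y := by
    intro x y hxy
    obtain ⟨i, hi, rfl, rfl⟩ := mem_walkArcs.1 hxy
    exact hq i hi
  have hPπ : ∀ x y, (x, y) ∈ P → π x < π y := by
    intro x y hxy
    obtain ⟨i, hi, rfl, rfl⟩ := mem_walkArcs.1 hxy
    exact h.step i hi
  set C := P.filter fun e => e.swap ∈ Q with hC
  have hCP : C ⊆ P := Finset.filter_subset _ _
  have hCQ : C.image Prod.swap ⊆ Q := by
    intro e he
    obtain ⟨e', he', rfl⟩ := Finset.mem_image.1 he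
    exact (Finset.mem_filter.1 he').2
  have hQ1 : ∀ x y, (x, y) ∈ Q \ C.image Prod.swap →
      G.Adj x y ∧ π y = π x + 1 := by
    intro x y hxy
    obtain ⟨h1, h2⟩ := Finset.mem_sdiff.1 hxy
    rcases hQt x y h1 with ⟨h3, -, -, h4⟩ | ⟨h3, -⟩
    · exact ⟨h3, h4⟩
    · exact absurd (Finset.mem_image.2 ⟨(y, x), Finset.mem_filter.2 ⟨(memP _ _).2 h3, h1⟩, rfl⟩) h2
  have hQ2 : ∀ x y, (x, y) ∈ C.image Prod.swap → π x = π y + 1 := by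
    intro x y hxy
    obtain ⟨⟨a, b⟩, he', he⟩ := Finset.mem_image.1 hxy
    obtain ⟨rfl, rfl⟩ : b = x ∧ a = y := by simpa using he
    have h3 := hPπ _ _ (hCP he')
    rcases hQt _ _ (hCQ hxy) with ⟨-, -, -, h4⟩ | ⟨-, h4⟩ <;> omega
  have hdisj : Disjoint (P \ C) (Q \ C.image Prod.swap) := by
    rw [Finset.disjoint_left]
    rintro ⟨x, y⟩ h1 h2
    have h3 := (memP _ _).1 (Finset.mem_sdiff.1 h1).1
    have h5 := hPπ _ _ (Finset.mem_sdiff.1 h1).1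
    rcases hQt _ _ (Finset.mem_sdiff.1 h2).1 with ⟨-, h4, -⟩ | ⟨-, h4⟩
    · exact h4 h3
    · omega
  set A := (P \ C) ∪ (Q \ C.image Prod.swap) with hA
  have hcardC : (C.image Prod.swap).card = C.card :=
    Finset.card_image_of_injective _ Prod.swap_injective
  have hexc : ∀ x, excess A x = (if p 0 = x then 1 else 0) + (if q 0 = x then 1 else 0)
      - 2 * (if p D = x then 1 else 0) := by
    intro x
    rw [excess, hA, Finset.sum_union hdisj, ← excess, ← excess, excess_sdiff hCP, excess_sdiff hCQ,
      excess_image_swap, excess_walkArcs hpi, excess_walkArcs hqi, hqm]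
    ring
  have hsum : ((Q \ C.image Prod.swap).card : ℤ) - C.card = π (p D) := by
    have h1 := sum_walkArcs hqi fun e => (π e.2 : ℤ) - π e.1
    rw [Finset.sum_range_sub (fun i => (π (q i) : ℤ)), hqm, h.zero _ hq0, ← hQ,
      ← Finset.sum_sdiff hCQ, Finset.sum_congr rfl (g := fun _ => (1 : ℤ)),
      Finset.sum_congr (s₁ := C.image Prod.swap) rfl (g := fun _ => (-1 : ℤ))] at h1
    · simp [hcardC] at h1
      linarith
    · rintro ⟨x, y⟩ he
      have := hQ2 x y he
      simp only [this]; push_cast; ring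
    · rintro ⟨x, y⟩ he
      have := (hQ1 x y he).2
      simp only [this]; push_cast; ring
  have hcard : A.card ≤ D + π (p D) := by
    have h1 : A.card = (P \ C).card + (Q \ C.image Prod.swap).card :=
      Finset.card_union_of_disjoint hdisj
    have h2 : (P \ C).card = D - C.card := by
      rw [Finset.card_sdiff_of_subset hCP, card_walkArcs hpi]
    have h3 := Finset.card_le_card hCP
    rw [card_walkArcs hpi] at h3
    omega
  have hasc : ∀ x y, (x, y) ∈ A → AscentArc G p D π x y := by
    intro x y hxy
    rcases Finset.mem_union.1 hxy with h1 | h1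
    · have h2 := (Finset.mem_sdiff.1 h1).1
      have h3 := hPπ _ _ h2
      rw [memP] at h2
      obtain ⟨a, ha, rfl, rfl⟩ := id h2
      exact ⟨hp a ha, h3, Or.inl h2⟩
    · have h2 := hQ1 _ _ h1
      exact ⟨h2.1, by omega, Or.inr h2.2⟩
  obtain ⟨n₁, f₁, n₂, f₂, h1, h2, h3, h4, h5, h6, h7, h8⟩ := exists_two_walks (A := A) (π := π)
    (fun e he => (hasc e.1 e.2 he).2.1) (hne _ hp0) (hne _ hq0) hexc
  exact ⟨n₁, f₁, n₂, f₂, h1 ▸ hp0, h2, h3 ▸ hq0, h4, fun i hi => hasc _ _ (h5 i hi),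
    fun i hi => hasc _ _ (h6 i hi), h7, h8.trans hcard⟩

/-- Adding two arc-disjoint paths from `S` to a common end, one of them reversed. -/
theorem IsPartialOrientation.exists_extension_two_paths {V : Type*} [DecidableEq V]
    {G : SimpleGraph V} {S : Finset V} {O : V → V → Prop} (hO : IsPartialOrientation G S O)
    {d : ℕ} (hd : ∀ x ∈ S, ∀ y ∈ S, ∃ m ≤ d, StepReach O m x y) {π : V → ℕ}
    (hπ : ∀ x ∈ S, π x = 0) {n₁ n₂ : ℕ} {f₁ f₂ : ℕ → V} (h₁ : f₁ 0 ∈ S) (h₂ : f₂ 0 ∈ S)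
    (hv : f₁ n₁ = f₂ n₂) (hf₁ : ∀ i < n₁, G.Adj (f₁ i) (f₁ (i + 1)) ∧ π (f₁ i) < π (f₁ (i + 1)))
    (hf₂ : ∀ i < n₂, G.Adj (f₂ i) (f₂ (i + 1)) ∧ π (f₂ i) < π (f₂ (i + 1)))
    (hdisj : ∀ i < n₁, ∀ j < n₂, ¬ (f₁ i = f₂ j ∧ f₁ (i + 1) = f₂ (j + 1))) {S' : Finset V}
    (hS' : S' = S ∪ ((Finset.Icc 1 n₁).image f₁ ∪ (Finset.Icc 1 n₂).image f₂)) :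
    ∃ O' : V → V → Prop, IsPartialOrientation G S' O' ∧
      ∀ x ∈ S', ∀ y ∈ S', ∃ m ≤ d + (S' \ S).card, StepReach O' m x y := by
  have hSS' : ∀ x ∈ S, x ∈ S' := fun x hx => hS' ▸ Finset.mem_union_left _ hx
  have hm₁ : ∀ i ≤ n₁, f₁ i ∈ S' := by
    intro i hi
    rcases Nat.eq_zero_or_pos i with rfl | h0
    · exact hSS' _ h₁
    · rw [hS']
      exact Finset.mem_union_right _ (Finset.mem_union_left _
        (Finset.mem_image_of_mem _ (Finset.mem_Icc.2 ⟨h0, hi⟩)))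
  have hm₂ : ∀ i ≤ n₂, f₂ i ∈ S' := by
    intro i hi
    rcases Nat.eq_zero_or_pos i with rfl | h0
    · exact hSS' _ h₂
    · rw [hS']
      exact Finset.mem_union_right _ (Finset.mem_union_right _
        (Finset.mem_image_of_mem _ (Finset.mem_Icc.2 ⟨h0, hi⟩)))
  have key : ∀ x y, (x ∈ S ∧ y ∈ S) → ¬ π x < π y := by
    rintro x y ⟨hx, hy⟩
    rw [hπ x hx, hπ y hy]
    exact lt_irrefl _
  let O' : V → V → Prop := fun x y => O x y ∨ PathArc f₁ n₁ x y ∨ PathArc f₂ n₂ y x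
  have hp₁ : ∀ x y, PathArc f₁ n₁ x y → G.Adj x y ∧ π x < π y := by
    rintro x y ⟨i, hi, rfl, rfl⟩
    exact hf₁ i hi
  have hp₂ : ∀ x y, PathArc f₂ n₂ x y → G.Adj x y ∧ π x < π y := by
    rintro x y ⟨i, hi, rfl, rfl⟩
    exact hf₂ i hi
  have hp : ∀ x y, PathArc f₁ n₁ x y → ¬ PathArc f₂ n₂ x y := by
    rintro x y ⟨i, hi, rfl, rfl⟩ ⟨j, hj, h1, h2⟩
    exact hdisj i hi j hj ⟨h1.symm, h2.symm⟩
  have hpm₁ : ∀ x y, PathArc f₁ n₁ x y → x ∈ S' ∧ y ∈ S' := by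
    rintro x y ⟨i, hi, rfl, rfl⟩
    exact ⟨hm₁ _ hi.le, hm₁ _ hi⟩
  have hpm₂ : ∀ x y, PathArc f₂ n₂ x y → x ∈ S' ∧ y ∈ S' := by
    rintro x y ⟨i, hi, rfl, rfl⟩
    exact ⟨hm₂ _ hi.le, hm₂ _ hi⟩
  have hmem : ∀ x y, O x y → x ∈ S ∧ y ∈ S := fun x y h => ⟨hO.left_mem _ _ h, hO.right_mem _ _ h⟩
  have hO' : IsPartialOrientation G S' O' := by
    refine ⟨?_, ?_, ?_, ?_⟩
    · rintro x y (h | h | h)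
      · exact hO.adj _ _ h
      · exact (hp₁ _ _ h).1
      · exact (hp₂ _ _ h).1.symm
    · rintro x y (h | h | h) (h' | h' | h')
      · exact hO.asymm _ _ h h'
      · exact key _ _ (hmem _ _ h).symm (hp₁ _ _ h').2
      · exact key _ _ (hmem _ _ h) (hp₂ _ _ h').2
      · exact key _ _ (hmem _ _ h').symm (hp₁ _ _ h).2
      · exact lt_asymm (hp₁ _ _ h).2 (hp₁ _ _ h').2
      · exact hp _ _ h h'
      · exact key _ _ (hmem _ _ h') (hp₂ _ _ h).2
      · exact hp _ _ h' h
      · exact lt_asymm (hp₂ _ _ h).2 (hp₂ _ _ h').2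
    · rintro x y (h | h | h)
      · exact hSS' _ (hmem _ _ h).1
      · exact (hpm₁ _ _ h).1
      · exact (hpm₂ _ _ h).2
    · rintro x y (h | h | h)
      · exact hSS' _ (hmem _ _ h).2
      · exact (hpm₁ _ _ h).2
      · exact (hpm₂ _ _ h).1
  have hOO' : ∀ x y, O x y → O' x y := fun x y h => Or.inl h
  have seg₁ : ∀ i j, i ≤ j → j ≤ n₁ → StepReach O' (j - i) (f₁ i) (f₁ j) := by
    intro i j hij hj
    have := StepReach.of_seq (O := O') f₁ i (j - i)
      fun k h1 h2 => Or.inr (Or.inl ⟨k, by omega, rfl, rfl⟩)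
    rwa [Nat.add_sub_cancel' hij] at this
  have seg₂ : ∀ i j, i ≤ j → j ≤ n₂ → StepReach O' (j - i) (f₂ j) (f₂ i) := by
    intro i j hij hj
    have := StepReach.of_seq (O := O') (fun k => f₂ (j - k)) 0 (j - i)
      fun k h1 h2 => Or.inr (Or.inr ⟨j - (k + 1), by omega, rfl, by
        rw [show j - (k + 1) + 1 = j - k by omega]⟩)
    simpa [Nat.sub_sub_self hij] using this
  have hfrom : ∀ y ∈ S', (∃ s ∈ S, ∃ n, StepReach O' n s y) ∧ ∃ s ∈ S, ∃ n, StepReach O' n y s := by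
    intro y hy
    rw [hS'] at hy
    rcases Finset.mem_union.1 hy with hy | hy
    · exact ⟨⟨y, hy, 0, rfl⟩, y, hy, 0, rfl⟩
    rcases Finset.mem_union.1 hy with hy | hy
    · obtain ⟨i, hi, rfl⟩ := Finset.mem_image.1 hy
      have hi := (Finset.mem_Icc.1 hi).2
      refine ⟨⟨_, h₁, _, seg₁ 0 i (Nat.zero_le _) hi⟩, _, h₂, _,
        (seg₁ i n₁ hi le_rfl).trans (hv ▸ seg₂ 0 n₂ (Nat.zero_le _) le_rfl)⟩
    · obtain ⟨i, hi, rfl⟩ := Finset.mem_image.1 hy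
      have hi := (Finset.mem_Icc.1 hi).2
      refine ⟨⟨_, h₁, _,
        (seg₁ 0 n₁ (Nat.zero_le _) le_rfl).trans (hv ▸ seg₂ i n₂ hi le_rfl)⟩, _, h₂, _,
        seg₂ 0 i (Nat.zero_le _) hi⟩
  refine ⟨O', hO', fun x hx y hy => ?_⟩
  refine exists_stepReach_le_add_card_sdiff hOO' hO'.right_mem hd hx ?_
  obtain ⟨-, s, hs, n, hn⟩ := hfrom x hx
  obtain ⟨⟨t, ht, n', hn'⟩, -⟩ := hfrom y hy
  obtain ⟨k, -, hk⟩ := hd s hs t ht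
  exact ⟨_, (hn.trans (hk.mono hOO')).trans hn'⟩

/-- The number of ends at height `3 * i` of the jumps (increments by at least two) among the first
`D` increments of `u`. -/
def jumpEnds (u : ℕ → ℕ) (D i : ℕ) : ℕ :=
  ((Finset.range D).filter fun b => u b + 2 ≤ u (b + 1) ∧ u b = 3 * i).card +
    ((Finset.range D).filter fun b => u b + 2 ≤ u (b + 1) ∧ u (b + 1) = 3 * i).card

section JumpEnds

variable {u : ℕ → ℕ} {D : ℕ}

theorem eq_of_step_eq (hu : ∀ b < D, u b < u (b + 1)) {a b : ℕ} (ha : a ≤ D) (hb : b ≤ D)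
    (h : u a = u b) : a = b := by
  rcases lt_trichotomy a b with hab | hab | hab
  · have := lt_of_forall_lt_succ (f := u) (π := id) hu hab hb
    simp only [id] at this
    omega
  · exact hab
  · have := lt_of_forall_lt_succ (f := u) (π := id) hu hab ha
    simp only [id] at this
    omega

theorem card_jump_start_le_one (hu : ∀ b < D, u b < u (b + 1)) (i : ℕ) :
    ((Finset.range D).filter fun b => u b + 2 ≤ u (b + 1) ∧ u b = 3 * i).card ≤ 1 := by
  refine Finset.card_le_one.2 fun a ha b hb => ?_
  simp only [Finset.mem_filter, Finset.mem_range] at ha hb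
  exact eq_of_step_eq hu ha.1.le hb.1.le (by omega)

theorem card_jump_stop_le_one (hu : ∀ b < D, u b < u (b + 1)) (i : ℕ) :
    ((Finset.range D).filter fun b => u b + 2 ≤ u (b + 1) ∧ u (b + 1) = 3 * i).card ≤ 1 := by
  refine Finset.card_le_one.2 fun a ha b hb => ?_
  simp only [Finset.mem_filter, Finset.mem_range] at ha hb
  have := eq_of_step_eq hu (a := a + 1) (b := b + 1) ha.1 hb.1 (by omega)
  omega

theorem jumpEnds_le_two (hu : ∀ b < D, u b < u (b + 1)) (i : ℕ) : jumpEnds u D i ≤ 2 := by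
  have h1 := card_jump_start_le_one hu i
  have h2 := card_jump_stop_le_one hu i
  unfold jumpEnds
  omega

theorem jumpEnds_zero_le_one (hu : ∀ b < D, u b < u (b + 1)) : jumpEnds u D 0 ≤ 1 := by
  have h1 := card_jump_start_le_one hu 0
  have h2 : ((Finset.range D).filter
      fun b => u b + 2 ≤ u (b + 1) ∧ u (b + 1) = 3 * 0).card = 0 := by
    rw [Finset.card_eq_zero, Finset.filter_eq_empty_iff]
    intro b _
    omega
  unfold jumpEnds
  omega

theorem jumpEnds_last_le_one (hu : ∀ b < D, u b < u (b + 1)) {k : ℕ} (hk : u D = 3 * k) :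
    jumpEnds u D k ≤ 1 := by
  have h1 := card_jump_stop_le_one hu k
  have h2 : ((Finset.range D).filter fun b => u b + 2 ≤ u (b + 1) ∧ u b = 3 * k).card = 0 := by
    rw [Finset.card_eq_zero, Finset.filter_eq_empty_iff]
    intro b hb h
    rw [Finset.mem_range] at hb
    have := eq_of_step_eq hu hb.le le_rfl (by omega)
    omega
  unfold jumpEnds
  omega

theorem sum_jumpEnds_add_le (hu : ∀ b < D, u b < u (b + 1)) (k : ℕ) :
    ∑ i ∈ Finset.range (k + 1), jumpEnds u D i + D + u 0 ≤ u D := by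
  have h1 : ∀ n : ℕ, ∑ i ∈ Finset.range (k + 1), (if n = 3 * i then 1 else 0) ≤
      if 3 ∣ n then 1 else 0 := by
    intro n
    rw [Finset.sum_boole, Nat.cast_id]
    split_ifs with h
    · refine Finset.card_le_one.2 fun a ha b hb => ?_
      simp only [Finset.mem_filter] at ha hb
      omega
    · rw [Nat.le_zero, Finset.card_eq_zero, Finset.filter_eq_empty_iff]
      intro b _
      omega
  have h2 : ∀ b ∈ Finset.range D, ∑ i ∈ Finset.range (k + 1),
      ((if u b + 2 ≤ u (b + 1) ∧ u b = 3 * i then 1 else 0) +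
        (if u b + 2 ≤ u (b + 1) ∧ u (b + 1) = 3 * i then 1 else 0)) ≤ u (b + 1) - u b - 1 := by
    intro b _
    by_cases hj : u b + 2 ≤ u (b + 1)
    · simp only [hj, true_and, Finset.sum_add_distrib]
      refine (add_le_add (h1 _) (h1 _)).trans ?_
      split_ifs <;> omega
    · simp [hj]
  have h3 : ∑ i ∈ Finset.range (k + 1), jumpEnds u D i ≤
      ∑ b ∈ Finset.range D, (u (b + 1) - u b - 1) := by
    refine le_trans (le_of_eq ?_) (Finset.sum_le_sum h2)
    rw [Finset.sum_comm]
    refine Finset.sum_congr rfl fun i _ => ?_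
    simp [jumpEnds, Finset.sum_add_distrib]
  have h4 : ∀ n ≤ D, ∑ b ∈ Finset.range n, (u (b + 1) - u b - 1) + n + u 0 = u n := by
    intro n hn
    induction n with
    | zero => simp
    | succ n ih =>
      rw [Finset.sum_range_succ]
      have := ih (by omega)
      have := hu n (by omega)
      omega
  have := h4 D le_rfl
  omega

end JumpEnds

/-- On every level the two paths provide a vertex that is off the path `p` or is shared. -/
theorem exists_center {V : Type*} {G : SimpleGraph V} {p : ℕ → V} {D : ℕ}
    {π : V → ℕ} (hp : ∀ a < D, π (p a) < π (p (a + 1))) {n₁ n₂ : ℕ} {f₁ f₂ : ℕ → V}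
    (h₁ : π (f₁ 0) = 0) (h₂ : π (f₂ 0) = 0) (hv₁ : f₁ n₁ = p D) (hv₂ : f₂ n₂ = p D)
    (hf₁ : ∀ i < n₁, AscentArc G p D π (f₁ i) (f₁ (i + 1)))
    (hf₂ : ∀ i < n₂, AscentArc G p D π (f₂ i) (f₂ (i + 1)))
    (hdisj : ∀ i < n₁, ∀ j < n₂, ¬ (f₁ i = f₂ j ∧ f₁ (i + 1) = f₂ (j + 1)))
    {l : ℕ} (hl : 0 < l) (hlD : l ≤ π (p D)) :
    ∃ c, π c = l ∧ (l = π (p D) → c = p D) ∧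
      (((∀ a ≤ D, c ≠ p a) ∧ ((∃ i, 1 ≤ i ∧ i ≤ n₁ ∧ f₁ i = c) ∨ ∃ i, 1 ≤ i ∧ i ≤ n₂ ∧ f₂ i = c)) ∨
      ((∃ a ≤ D, c = p a) ∧ (∃ i, 1 ≤ i ∧ i ≤ n₁ ∧ f₁ i = c) ∧
        ∃ i, 1 ≤ i ∧ i ≤ n₂ ∧ f₂ i = c)) := by
  have hpos : ∀ (n : ℕ) (f : ℕ → V), π (f 0) = 0 → f n = p D → 1 ≤ n := by
    intro n f h0 hn
    by_contra! h
    obtain rfl : n = 0 := by omega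
    rw [hn] at h0
    omega
  rcases hlD.eq_or_lt with rfl | hlt
  · exact ⟨p D, rfl, fun _ => rfl, Or.inr ⟨⟨D, le_rfl, rfl⟩,
      ⟨n₁, hpos _ _ h₁ hv₁, le_rfl, hv₁⟩, n₂, hpos _ _ h₂ hv₂, le_rfl, hv₂⟩⟩
  have cross : ∀ (n : ℕ) (f : ℕ → V), π (f 0) = 0 → f n = p D →
      (∀ i < n, AscentArc G p D π (f i) (f (i + 1))) →
      (∃ i, 1 ≤ i ∧ i ≤ n ∧ π (f i) = l) ∨
        ∃ i < n, ∃ b < D, p b = f i ∧ p (b + 1) = f (i + 1) ∧ π (p b) < l ∧ l < π (p (b + 1)) := by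
    intro n f h0 hn hf
    have hex : ∃ i, l ≤ π (f i) := ⟨n, by rw [hn]; exact hlD⟩
    classical
    obtain ⟨i, hi⟩ : ∃ i, Nat.find hex = i := ⟨_, rfl⟩
    have h1 := Nat.find_spec hex
    rw [hi] at h1
    have hin : i ≤ n := hi ▸ Nat.find_min' hex (by rw [hn]; exact hlD)
    obtain _ | i := i
    · omega
    have h2 : π (f i) < l := not_le.1 (Nat.find_min hex (by omega))
    rcases h1.eq_or_lt with h1 | h1
    · exact Or.inl ⟨i + 1, by omega, hin, h1.symm⟩
    rcases (hf i (by omega)).2.2 with ⟨b, hb, hb1, hb2⟩ | h3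
    · exact Or.inr ⟨i, by omega, b, hb, hb1, hb2, by rwa [hb1], by rwa [hb2]⟩
    · omega
  have mono : ∀ {a b}, a < b → b ≤ D → π (p a) < π (p b) := fun h h' =>
    lt_of_forall_lt_succ (π := π) hp h h'
  have nojump : ∀ a ≤ D, π (p a) = l → ∀ b < D, π (p b) < l → l < π (p (b + 1)) → False := by
    intro a ha hal b hb h1 h2
    rcases le_or_gt a b with h | h
    · rcases h.eq_or_lt with rfl | h
      · omega
      · have := mono h hb.le
        omega
    · rcases (Nat.succ_le_of_lt h).eq_or_lt with h | h
      · rw [Nat.succ_eq_add_one] at h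
        rw [h] at h2
        omega
      · have := mono h ha
        rw [Nat.succ_eq_add_one] at this
        omega
  by_cases hoff : ∃ c, π c = l ∧ (∀ a ≤ D, c ≠ p a) ∧
      ((∃ i, 1 ≤ i ∧ i ≤ n₁ ∧ f₁ i = c) ∨ ∃ i, 1 ≤ i ∧ i ≤ n₂ ∧ f₂ i = c)
  · obtain ⟨c, hc, hc'⟩ := hoff
    exact ⟨c, hc, fun h => absurd h hlt.ne, Or.inl hc'⟩
  push Not at hoff
  have on₁ : ∀ i, 1 ≤ i → i ≤ n₁ → π (f₁ i) = l → ∃ a ≤ D, f₁ i = p a := by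
    intro i h1 h2 h3
    by_contra! h4
    exact (hoff _ h3 h4).1 i h1 h2 rfl
  have on₂ : ∀ i, 1 ≤ i → i ≤ n₂ → π (f₂ i) = l → ∃ a ≤ D, f₂ i = p a := by
    intro i h1 h2 h3
    by_contra! h4
    exact (hoff _ h3 h4).2 i h1 h2 rfl
  rcases cross n₁ f₁ h₁ hv₁ hf₁ with ⟨i, hi1, hi2, hi⟩ | ⟨i, hi, b, hb, hb1, hb2, hb3, hb4⟩ <;>
    rcases cross n₂ f₂ h₂ hv₂ hf₂ with
      ⟨j, hj1, hj2, hj⟩ | ⟨j, hj, b', hb', hb1', hb2', hb3', hb4'⟩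
  · obtain ⟨a, ha, hia⟩ := on₁ i hi1 hi2 hi
    obtain ⟨a', ha', hja⟩ := on₂ j hj1 hj2 hj
    obtain rfl : a = a' := eq_of_step_eq (u := fun a => π (p a)) hp ha ha' (by
      simp only [← hia, ← hja, hi, hj])
    exact ⟨f₁ i, hi, fun h => absurd h hlt.ne, Or.inr ⟨⟨a, ha, hia⟩, ⟨i, hi1, hi2, rfl⟩,
      j, hj1, hj2, hja.trans hia.symm⟩⟩
  · obtain ⟨a, ha, hia⟩ := on₁ i hi1 hi2 hi
    exact (nojump a ha (hia ▸ hi) b' hb' hb3' hb4').elim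
  · obtain ⟨a, ha, hja⟩ := on₂ j hj1 hj2 hj
    exact (nojump a ha (hja ▸ hj) b hb hb3 hb4).elim
  · have hbb : b = b' := by
      rcases lt_trichotomy b b' with h | h | h
      · rcases (Nat.succ_le_of_lt h).eq_or_lt with h | h
        · rw [Nat.succ_eq_add_one] at h
          rw [h] at hb4
          omega
        · have := mono h hb'.le
          rw [Nat.succ_eq_add_one] at this
          omega
      · exact h
      · rcases (Nat.succ_le_of_lt h).eq_or_lt with h | h
        · rw [Nat.succ_eq_add_one] at h
          rw [h] at hb4'
          omega
        · have := mono h hb.le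
          rw [Nat.succ_eq_add_one] at this
          omega
    subst hbb
    exact (hdisj i hi j hj ⟨hb1.symm.trans hb1', hb2.symm.trans hb2'⟩).elim

open Classical in
/-- The closed neighbourhood of a set of vertices. -/
noncomputable def closedNbhd {V : Type*} [Fintype V] (G : SimpleGraph V) (S : Finset V) :
    Finset V :=
  Finset.univ.filter fun x => ∃ s ∈ S, x = s ∨ G.Adj s x

theorem mem_closedNbhd {V : Type*} [Fintype V] {G : SimpleGraph V} {S : Finset V} {x : V} :
    x ∈ closedNbhd G S ↔ ∃ s ∈ S, x = s ∨ G.Adj s x := by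
  simp [closedNbhd]

theorem closedNbhd_mono {V : Type*} [Fintype V] {G : SimpleGraph V} {S T : Finset V}
    (h : S ⊆ T) : closedNbhd G S ⊆ closedNbhd G T := by
  intro x hx
  obtain ⟨s, hs, hx⟩ := mem_closedNbhd.1 hx
  exact mem_closedNbhd.2 ⟨s, h hs, hx⟩

theorem degree_succ_le_card_closedNbhd {V : Type*} [Fintype V] {G : SimpleGraph V}
    [DecidableRel G.Adj] (x : V) : G.degree x + 1 ≤ (closedNbhd G {x}).card := by
  classical
  rw [← G.card_neighborFinset_eq_degree, ← Finset.card_insert_of_notMem (a := x) (by simp)]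
  refine Finset.card_le_card fun y hy => ?_
  rw [Finset.mem_insert, mem_neighborFinset] at hy
  exact mem_closedNbhd.2 ⟨x, Finset.mem_singleton_self x, hy⟩

namespace IsPathPotential

variable {V : Type*} {G : SimpleGraph V} {S : Finset V} {p : ℕ → V} {D : ℕ} {π : V → ℕ}

theorem pathArc_of_add_two_le (h : IsPathPotential G S p D π) {x y : V} (hxy : G.Adj x y)
    (hπ : π x + 2 ≤ π y) : PathArc p D x y := by
  have h2 : ¬ PathArc p D y x := by
    rintro ⟨i, hi, rfl, rfl⟩
    have := h.step i hi
    omega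
  by_contra h3
  have := h.adj x y hxy h3 h2
  omega

open Classical in
/-- Only ends of jumps lose neighbours when restricting to nearby heights. -/
theorem card_closedNbhd_le (h : IsPathPotential G S p D π) [Fintype V] {c : V} {i : ℕ}
    (hc : π c = 3 * i) :
    (closedNbhd G {c}).card ≤
      ((closedNbhd G {c}).filter fun x => 3 * i ≤ π x + 1 ∧ π x ≤ 3 * i + 1).card +
        if ∃ a ≤ D, c = p a then jumpEnds (fun a => π (p a)) D i else 0 := by
  rw [← Finset.card_filter_add_card_filter_not
    (p := fun x => 3 * i ≤ π x + 1 ∧ π x ≤ 3 * i + 1)]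
  refine Nat.add_le_add_left ?_ _
  have key : ∀ x ∈ (closedNbhd G {c}).filter fun x => ¬ (3 * i ≤ π x + 1 ∧ π x ≤ 3 * i + 1),
      PathArc p D c x ∧ π c + 2 ≤ π x ∨ PathArc p D x c ∧ π x + 2 ≤ π c := by
    intro x hx
    simp only [Finset.mem_filter, mem_closedNbhd, Finset.mem_singleton, exists_eq_left] at hx
    obtain ⟨rfl | hx, hne⟩ := hx
    · omega
    · rcases le_or_gt (π c + 2) (π x) with h1 | h1
      · exact Or.inl ⟨h.pathArc_of_add_two_le hx h1, h1⟩
      · have h2 : π x + 2 ≤ π c := by omega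
        exact Or.inr ⟨h.pathArc_of_add_two_le hx.symm h2, h2⟩
  split_ifs with hp
  · refine (Finset.card_le_card (t := ((Finset.range D).filter
      fun b => π (p b) + 2 ≤ π (p (b + 1)) ∧ π (p b) = 3 * i).image (fun b => p (b + 1)) ∪
      ((Finset.range D).filter
      fun b => π (p b) + 2 ≤ π (p (b + 1)) ∧ π (p (b + 1)) = 3 * i).image p) ?_).trans
      ((Finset.card_union_le _ _).trans (add_le_add Finset.card_image_le Finset.card_image_le))
    intro x hx
    rcases key x hx with ⟨⟨b, hb, rfl, rfl⟩, h1⟩ | ⟨⟨b, hb, rfl, rfl⟩, h1⟩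
    · exact Finset.mem_union_left _ (Finset.mem_image.2 ⟨b, Finset.mem_filter.2 ⟨Finset.mem_range.2 hb, h1, hc⟩, rfl⟩)
    · exact Finset.mem_union_right _ (Finset.mem_image.2 ⟨b, Finset.mem_filter.2 ⟨Finset.mem_range.2 hb, h1, hc⟩, rfl⟩)
  · rw [Nat.le_zero, Finset.card_eq_zero, Finset.eq_empty_iff_forall_notMem]
    intro x hx
    rcases key x hx with ⟨⟨b, hb, h1, -⟩, -⟩ | ⟨⟨b, hb, -, h1⟩, -⟩
    · exact hp ⟨b, hb.le, h1.symm⟩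
    · exact hp ⟨b + 1, hb, h1.symm⟩

open Classical in
theorem card_inter_closedNbhd_le (h : IsPathPotential G S p D π) [Fintype V] :
    ((closedNbhd G S).filter fun x => 2 ≤ π x).card ≤ jumpEnds (fun a => π (p a)) D 0 := by
  refine (Finset.card_le_card (t := ((Finset.range D).filter
      fun b => π (p b) + 2 ≤ π (p (b + 1)) ∧ π (p b) = 3 * 0).image (fun b => p (b + 1))) ?_).trans
      (Finset.card_image_le.trans (Nat.le_add_right _ _))
  intro x hx
  simp only [Finset.mem_filter, mem_closedNbhd] at hx
  obtain ⟨⟨s, hs, hx⟩, h2⟩ := hx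
  have h0 := h.zero s hs
  rcases hx with rfl | hx
  · omega
  · obtain ⟨b, hb, rfl, rfl⟩ := h.pathArc_of_add_two_le hx (by omega)
    exact Finset.mem_image.2 ⟨b, Finset.mem_filter.2 ⟨Finset.mem_range.2 hb, by omega, h0⟩, rfl⟩

open Classical in
/-- Adding vertices at heights `3, 6, …, 3 * k` enlarges the closed neighbourhood by about
`k * (δ + 1)` vertices. -/
theorem card_closedNbhd_add_le (h : IsPathPotential G S p D π) [Fintype V] [DecidableRel G.Adj]
    {δ k : ℕ} (hδ : ∀ x, δ ≤ G.degree x) (hpS : p D ∉ closedNbhd G S) {c : ℕ → V}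
    (hc : ∀ i, 1 ≤ i → i ≤ k → π (c i) = 3 * i) {S' : Finset V} (hSS' : S ⊆ S')
    (hcS' : ∀ i, 1 ≤ i → i ≤ k → c i ∈ S') (hpS' : p D ∈ S') :
    (closedNbhd G S).card + k * (δ + 1) + (if π (p D) = 3 * k + 2 then 1 else 0) ≤
      (closedNbhd G S').card +
        ∑ i ∈ (Finset.Icc 1 k).filter (fun i => ∃ a ≤ D, c i = p a),
          jumpEnds (fun a => π (p a)) D i + jumpEnds (fun a => π (p a)) D 0 := by
  set E : ℕ → Finset V := fun i =>
    (closedNbhd G {c i}).filter fun x => 3 * i ≤ π x + 1 ∧ π x ≤ 3 * i + 1 with hE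
  set U := (Finset.Icc 1 k).biUnion E with hU
  set F : Finset V := if π (p D) = 3 * k + 2 then {p D} else ∅ with hF
  have hEmem : ∀ i x, x ∈ E i → 3 * i ≤ π x + 1 ∧ π x ≤ 3 * i + 1 :=
    fun i x hx => (Finset.mem_filter.1 hx).2
  have hUcard : k * (δ + 1) ≤ U.card +
      ∑ i ∈ (Finset.Icc 1 k).filter (fun i => ∃ a ≤ D, c i = p a),
          jumpEnds (fun a => π (p a)) D i := by
    rw [hU, Finset.card_biUnion, Finset.sum_filter, ← Finset.sum_add_distrib]
    · have h1 : ∑ _i ∈ Finset.Icc 1 k, (δ + 1) = k * (δ + 1) := by simp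
      rw [← h1]
      refine Finset.sum_le_sum fun i hi => ?_
      rw [Finset.mem_Icc] at hi
      have h2 := h.card_closedNbhd_le (hc i hi.1 hi.2)
      have h3 := degree_succ_le_card_closedNbhd (G := G) (c i)
      have h4 := hδ (c i)
      exact le_trans (by omega) h2
    · intro i _ j _ hij
      refine Finset.disjoint_left.2 fun x hx hy => ?_
      have := hEmem i x hx
      have := hEmem j x hy
      omega
  have hFcard : F.card = if π (p D) = 3 * k + 2 then 1 else 0 := by
    rw [hF]
    split_ifs <;> simp
  have hFmem : ∀ x ∈ F, x = p D ∧ π (p D) = 3 * k + 2 := by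
    intro x hx
    rw [hF] at hx
    split_ifs at hx with h1
    · exact ⟨Finset.mem_singleton.1 hx, h1⟩
    · simp at hx
  have hUF : Disjoint (closedNbhd G S ∪ U) F := by
    rw [Finset.disjoint_right]
    intro x hx hx'
    obtain ⟨rfl, h1⟩ := hFmem x hx
    rcases Finset.mem_union.1 hx' with h2 | h2
    · exact hpS h2
    · obtain ⟨i, hi, h3⟩ := Finset.mem_biUnion.1 h2
      have := hEmem i _ h3
      rw [Finset.mem_Icc] at hi
      omega
  have hinter : (closedNbhd G S ∩ U).card ≤ jumpEnds (fun a => π (p a)) D 0 := by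
    refine (Finset.card_le_card fun x hx => ?_).trans h.card_inter_closedNbhd_le
    obtain ⟨h1, h2⟩ := Finset.mem_inter.1 hx
    obtain ⟨i, hi, h3⟩ := Finset.mem_biUnion.1 h2
    have := hEmem i _ h3
    rw [Finset.mem_Icc] at hi
    exact Finset.mem_filter.2 ⟨h1, by omega⟩
  have hsub : closedNbhd G S ∪ U ∪ F ⊆ closedNbhd G S' := by
    intro x hx
    rcases Finset.mem_union.1 hx with hx | hx
    · rcases Finset.mem_union.1 hx with hx | hx
      · exact closedNbhd_mono hSS' hx
      · obtain ⟨i, hi, h3⟩ := Finset.mem_biUnion.1 hx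
        rw [Finset.mem_Icc] at hi
        exact closedNbhd_mono (Finset.singleton_subset_iff.2 (hcS' i hi.1 hi.2))
          (Finset.mem_filter.1 h3).1
    · obtain ⟨rfl, -⟩ := hFmem x hx
      exact mem_closedNbhd.2 ⟨_, hpS', Or.inl rfl⟩
  have h1 := Finset.card_le_card hsub
  rw [Finset.card_union_of_disjoint hUF, hFcard] at h1
  have h2 := Finset.card_union_add_card_inter (closedNbhd G S) U
  omega

end IsPathPotential

theorem growth_arithmetic {L k t σ δ f loss N N' : ℕ} (hL : 1 ≤ L) (ht : t < 3)
    (hk : 3 * L + 1 ≤ 3 * k + t) (hδ : 5 ≤ δ)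
    (hf : f + σ + (if t = 0 then 0 else 1) ≤ 3 * L + 1 + (3 * k + t))
    (hloss : loss + (if t = 0 then 1 else 0) ≤ 2 * σ + 1)
    (hloss' : loss + (3 * L + 1) ≤ 3 * k + t)
    (hN : N + k * δ + (if t = 2 then 1 else 0) ≤ N' + loss) :
    f * L * δ + (6 * L + 2) * N ≤ (6 * L + 2) * N' := by
  obtain ⟨j, rfl⟩ : ∃ j, k = L + j := ⟨k - L, by omega⟩
  obtain ⟨e, rfl⟩ : ∃ e, δ = 5 + e := ⟨δ - 5, by omega⟩
  zify at *
  set a : ℤ := (if (t : ℤ) = 0 then 1 else 0) with ha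
  have hf' : (f : ℤ) ≤ 6 * L + 3 * j + t - σ + a := by
    rw [ha]
    split_ifs at hf ⊢ <;> linarith
  set b : ℤ := (if (t : ℤ) = 2 then 1 else 0) with hb
  have hX : (L : ℤ) * (3 * j + 2 - t + σ - a) + 2 * j ≤
      (6 * L + 2) * (L + j) - f * L := by nlinarith
  have hta : (t : ℤ) = 0 ∧ a = 1 ∧ b = 0 ∨ (t : ℤ) = 1 ∧ a = 0 ∧ b = 0 ∨
      (t : ℤ) = 2 ∧ a = 0 ∧ b = 1 := by
    have : t = 0 ∨ t = 1 ∨ t = 2 := by omega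
    rcases this with rfl | rfl | rfl <;> simp [ha, hb]
  set X : ℤ := (L : ℤ) * (3 * j + 2 - t + σ - a) + 2 * j with hXdef
  have hkey : (6 * (L : ℤ) + 2) * (loss - b) ≤ 5 * X ∧ 0 ≤ X := by
    have h1 : (loss : ℤ) - b ≤ 2 * σ + 1 - a - b := by linarith
    have h2 : (loss : ℤ) - b ≤ 3 * j + t - 1 - b := by linarith
    have h3 : 5 * (L : ℤ) * (loss - b) ≤ 5 * L * (2 * σ + 1 - a - b) :=
      mul_le_mul_of_nonneg_left h1 (by positivity)
    have h4 : (7 * (L : ℤ) + 4) * (loss - b) ≤ (7 * L + 4) * (3 * j + t - 1 - b) :=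
      mul_le_mul_of_nonneg_left h2 (by positivity)
    have h5 : 0 ≤ (L : ℤ) * j := by positivity
    have h6 : 0 ≤ (L : ℤ) * σ := by positivity
    have h7 : 0 ≤ (L : ℤ) * loss := by positivity
    rcases hta with ⟨h, h', h''⟩ | ⟨h, h', h''⟩ | ⟨h, h', h''⟩ <;>
      simp only [h, h', h''] at h3 h4 hXdef ⊢ <;> constructor <;> nlinarith
  have h1 : 5 * X ≤ (5 + e) * ((6 * L + 2) * (L + j) - f * L) := by
    have : 0 ≤ (e : ℤ) * X := mul_nonneg (by positivity) hkey.2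
    have := mul_le_mul_of_nonneg_left hX (show (0 : ℤ) ≤ 5 + e by positivity)
    linarith
  have h2 : (6 * (L : ℤ) + 2) * (N + (L + j) * (5 + e) + b) ≤ (6 * L + 2) * (N' + loss) :=
    mul_le_mul_of_nonneg_left hN (by positivity)
  linarith [hkey.1]

/-- If some vertex is far from `S`, then `S` can be enlarged efficiently. -/
theorem IsPartialOrientation.exists_growth {V : Type*} [Fintype V] {G : SimpleGraph V}
    [DecidableRel G.Adj] (hconn : G.Connected) (hb : ∀ e : Sym2 V, ¬ G.IsBridge e)
    {δ : ℕ} (hδ : ∀ x, δ ≤ G.degree x) (hδ4 : 4 ≤ δ) {L : ℕ} (hL : 1 ≤ L)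
    {S : Finset V} (hS : S.Nonempty) {O : V → V → Prop} (hO : IsPartialOrientation G S O) {d : ℕ}
    (hd : ∀ x ∈ S, ∀ y ∈ S, ∃ m ≤ d, StepReach O m x y)
    (hfar : ¬ ∀ x, ∃ n ≤ 3 * L, ∃ s ∈ S, StepReach G.Adj n s x) :
    ∃ (S' : Finset V) (O' : V → V → Prop) (f : ℕ), S ⊂ S' ∧ IsPartialOrientation G S' O' ∧
      (∀ x ∈ S', ∀ y ∈ S', ∃ m ≤ d + f, StepReach O' m x y) ∧
      f * L * (δ + 1) + (6 * L + 2) * (closedNbhd G S).card ≤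
        (6 * L + 2) * (closedNbhd G S').card := by
  classical
  obtain ⟨l, hl0, hl1, -, hlr, -⟩ := exists_level hconn S hS
  push Not at hfar
  obtain ⟨x₀, hx₀⟩ := hfar
  obtain ⟨s₀, hs₀, hr₀⟩ := hlr x₀
  have hlx : 3 * L + 1 ≤ l x₀ := by
    by_contra! h
    exact hx₀ (l x₀) (by omega) s₀ hs₀ hr₀
  obtain ⟨p, hp0, hpx, hp⟩ := hr₀.exists_seq
  have hlp : ∀ a ≤ l x₀, l (p a) = a := by
    have h1 : ∀ a ≤ l x₀, l (p a) ≤ a := by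
      intro a ha
      induction a with
      | zero => rw [hp0, (hl0 s₀).2 hs₀]
      | succ a ih =>
        have := hl1 _ _ (hp a (by omega))
        have := ih (by omega)
        omega
    have h2 : ∀ b ≤ l x₀, l x₀ ≤ l (p (l x₀ - b)) + b := by
      intro b hb
      induction b with
      | zero => simp [hpx]
      | succ b ih =>
        have h3 := hl1 _ _ (hp (l x₀ - (b + 1)) (by omega))
        rw [show l x₀ - (b + 1) + 1 = l x₀ - b by omega] at h3
        have := ih (by omega)
        omega
    intro a ha
    have h3 := h2 (l x₀ - a) (by omega)
    rw [Nat.sub_sub_self ha] at h3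
    have := h1 a ha
    omega
  obtain ⟨D, hDdef⟩ : ∃ D, D = 3 * L + 1 := ⟨_, rfl⟩
  have hpadj : ∀ a < D, G.Adj (p a) (p (a + 1)) := fun a ha => hp a (by omega)
  have hp0S : p 0 ∈ S := hp0 ▸ hs₀
  have hpot₀ : IsPathPotential G S p D l := by
    refine ⟨fun x hx => (hl0 x).2 hx, fun x y hxy _ _ => hl1 x y hxy, fun a ha => ?_⟩
    rw [hlp a (by omega), hlp (a + 1) (by omega)]
  obtain ⟨π, hπ, hreach⟩ := exists_isPathPotential hpot₀ hconn hb hp0S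
  obtain ⟨n₁, f₁, n₂, f₂, h10, h1n, h20, h2n, hf₁, hf₂, hdisj, hn⟩ :=
    hπ.exists_two_paths hpadj (by omega) hp0S (hreach _)
  have hDK : D ≤ π (p D) := by
    have := hπ.add_le (Nat.zero_le D) le_rfl
    omega
  have hpD : p D ∉ closedNbhd G S := by
    intro h
    obtain ⟨s, hs, h⟩ := mem_closedNbhd.1 h
    have h1 := hlp D (by omega)
    have h2 := (hl0 s).2 hs
    rcases h with h | h
    · rw [h] at h1
      omega
    · have := hl1 _ _ h
      omega
  set I₁ := (Finset.Icc 1 n₁).image f₁ with hI₁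
  set I₂ := (Finset.Icc 1 n₂).image f₂ with hI₂
  have hmem : ∀ (n : ℕ) (f : ℕ → V) (c : V), (∃ i, 1 ≤ i ∧ i ≤ n ∧ f i = c) →
      c ∈ (Finset.Icc 1 n).image f := by
    rintro n f c ⟨i, h1, h2, rfl⟩
    exact Finset.mem_image_of_mem _ (Finset.mem_Icc.2 ⟨h1, h2⟩)
  obtain ⟨S', hS'⟩ : ∃ S', S' = S ∪ (I₁ ∪ I₂) := ⟨_, rfl⟩
  obtain ⟨O', hO', hd'⟩ := hO.exists_extension_two_paths hd hπ.zero h10 h20 (h1n.trans h2n.symm)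
    (fun i hi => ⟨(hf₁ i hi).1, (hf₁ i hi).2.1⟩) (fun i hi => ⟨(hf₂ i hi).1, (hf₂ i hi).2.1⟩)
    hdisj hS'
  have hSS' : S ⊆ S' := hS' ▸ Finset.subset_union_left
  obtain ⟨k, t, ht, hkt⟩ : ∃ k t, t < 3 ∧ π (p D) = 3 * k + t :=
    ⟨π (p D) / 3, π (p D) % 3, Nat.mod_lt _ (by norm_num), (Nat.div_add_mod _ _).symm⟩
  have hex : ∀ i, ∃ c, 1 ≤ i → i ≤ k → π c = 3 * i ∧ (3 * i = π (p D) → c = p D) ∧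
      (((∀ a ≤ D, c ≠ p a) ∧ (c ∈ I₁ ∨ c ∈ I₂)) ∨ ((∃ a ≤ D, c = p a) ∧ c ∈ I₁ ∧ c ∈ I₂)) := by
    intro i
    by_cases hi : 1 ≤ i ∧ i ≤ k
    · obtain ⟨c, h1, h2, h3⟩ := exists_center (l := 3 * i) hπ.step (hπ.zero _ h10)
        (hπ.zero _ h20) h1n h2n hf₁ hf₂ hdisj (by omega) (by omega)
      refine ⟨c, fun _ _ => ⟨h1, h2, ?_⟩⟩
      rcases h3 with ⟨h3, h4⟩ | ⟨h3, h4, h5⟩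
      · exact Or.inl ⟨h3, h4.imp (hmem _ _ _) (hmem _ _ _)⟩
      · exact Or.inr ⟨h3, hmem _ _ _ h4, hmem _ _ _ h5⟩
    · exact ⟨x₀, fun h1 h2 => absurd ⟨h1, h2⟩ hi⟩
  choose c hc using hex
  set u : ℕ → ℕ := fun a => π (p a) with hu
  have hpD₁ : p D ∈ I₁ ∧ p D ∈ I₂ := by
    have h0 : ∀ (n : ℕ) (f : ℕ → V), f 0 ∈ S → f n = p D → 1 ≤ n := by
      intro n f h0 hn
      by_contra! h
      obtain rfl : n = 0 := by omega
      rw [hn] at h0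
      have := hπ.zero _ h0
      omega
    exact ⟨hmem _ _ _ ⟨n₁, h0 _ _ h10 h1n, le_rfl, h1n⟩,
      hmem _ _ _ ⟨n₂, h0 _ _ h20 h2n, le_rfl, h2n⟩⟩
  have hcS' : ∀ i, 1 ≤ i → i ≤ k → c i ∈ S' := by
    intro i h1 h2
    rw [hS']
    refine Finset.mem_union_right _ (Finset.mem_union.2 ?_)
    rcases (hc i h1 h2).2.2 with ⟨-, h⟩ | ⟨-, h, -⟩
    · exact h
    · exact Or.inl h
  have hpDS' : p D ∈ S' :=
    hS' ▸ Finset.mem_union_right _ (Finset.mem_union_left _ hpD₁.1)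
  have hcount := hπ.card_closedNbhd_add_le hδ hpD (fun i h1 h2 => (hc i h1 h2).1) hSS' hcS' hpDS'
  set Sh := (Finset.Icc 1 k).filter fun i => ∃ a ≤ D, c i = p a with hSh
  have hShmem : ∀ i ∈ Sh, 1 ≤ i ∧ i ≤ k ∧ c i ∈ I₁ ∩ I₂ := by
    intro i hi
    obtain ⟨h1, h2⟩ := Finset.mem_filter.1 hi
    rw [Finset.mem_Icc] at h1
    refine ⟨h1.1, h1.2, Finset.mem_inter.2 ?_⟩
    rcases (hc i h1.1 h1.2).2.2 with ⟨h, -⟩ | ⟨-, h⟩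
    · obtain ⟨a, ha, h3⟩ := h2
      exact absurd h3 (h a ha)
    · exact h
  have hinj : Set.InjOn c Sh := by
    intro i hi j hj hij
    have h1 := hShmem i hi
    have h2 := hShmem j hj
    have h3 := (hc i h1.1 h1.2.1).1
    have h4 := (hc j h2.1 h2.2.1).1
    rw [hij] at h3
    omega
  have hinter : Sh.card + (if t = 0 then 0 else 1) ≤ (I₁ ∩ I₂).card := by
    rw [← Finset.card_image_of_injOn hinj]
    have hsub : Sh.image c ⊆ I₁ ∩ I₂ := by
      intro x hx
      obtain ⟨i, hi, rfl⟩ := Finset.mem_image.1 hx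
      exact (hShmem i hi).2.2
    split_ifs with ht0
    · exact Finset.card_le_card hsub
    · rw [← Finset.card_insert_of_notMem (a := p D)]
      · exact Finset.card_le_card (Finset.insert_subset (Finset.mem_inter.2 hpD₁) hsub)
      · intro hx
        obtain ⟨i, hi, hi'⟩ := Finset.mem_image.1 hx
        have h1 := hShmem i hi
        have h2 := (hc i h1.1 h1.2.1).1
        rw [hi'] at h2
        omega
  have hf : (S' \ S).card + Sh.card + (if t = 0 then 0 else 1) ≤ D + (3 * k + t) := by
    have h1 : (S' \ S).card ≤ (I₁ ∪ I₂).card := by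
      refine Finset.card_le_card fun x hx => ?_
      rw [hS', Finset.mem_sdiff] at hx
      exact (Finset.mem_union.1 hx.1).resolve_left hx.2
    have h2 := Finset.card_union_add_card_inter I₁ I₂
    have h3 : I₁.card ≤ n₁ := Finset.card_image_le.trans (by simp)
    have h4 : I₂.card ≤ n₂ := Finset.card_image_le.trans (by simp)
    omega
  have hstep : ∀ a < D, u a < u (a + 1) := hπ.step
  have hz := jumpEnds_zero_le_one hstep
  have hloss : ∑ i ∈ Sh, jumpEnds u D i + jumpEnds u D 0 + (if t = 0 then 1 else 0) ≤
      2 * Sh.card + 1 := by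
    have h1 : ∀ T : Finset ℕ, ∑ i ∈ T, jumpEnds u D i ≤ 2 * T.card := by
      intro T
      have := Finset.sum_le_card_nsmul T (jumpEnds u D) 2 fun i _ => jumpEnds_le_two hstep i
      simpa [mul_comm] using this
    split_ifs with ht0
    · have hk : k ∈ Sh := by
        refine Finset.mem_filter.2 ⟨Finset.mem_Icc.2 ⟨by omega, le_rfl⟩, D, le_rfl, ?_⟩
        exact (hc k (by omega) le_rfl).2.1 (by omega)
      rw [← Finset.add_sum_erase _ _ hk]
      have h2 := h1 (Sh.erase k)
      have h3 := jumpEnds_last_le_one hstep (k := k) (by simp only [hu]; omega)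
      have h4 := Finset.card_erase_add_one hk
      omega
    · have := h1 Sh
      omega
  have hloss' : ∑ i ∈ Sh, jumpEnds u D i + jumpEnds u D 0 + (3 * L + 1) ≤ 3 * k + t := by
    have h1 := sum_jumpEnds_add_le hstep k
    have h0 : (0 : ℕ) ∉ Sh := fun h => absurd (hShmem 0 h).1 (by norm_num)
    have h2 : ∑ i ∈ insert 0 Sh, jumpEnds u D i ≤ ∑ i ∈ Finset.range (k + 1), jumpEnds u D i := by
      refine Finset.sum_le_sum_of_subset (Finset.insert_subset (by simp) fun i hi => ?_)
      have := (hShmem i hi).2.1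
      exact Finset.mem_range.2 (by omega)
    rw [Finset.sum_insert h0] at h2
    have h3 : u D = 3 * k + t := hkt
    omega
  refine ⟨S', O', (S' \ S).card, Finset.ssubset_iff_subset_ne.2 ⟨hSS', ?_⟩, hO', hd', ?_⟩
  · rintro rfl
    exact hpD (mem_closedNbhd.2 ⟨_, hpDS', Or.inl rfl⟩)
  · refine growth_arithmetic hL ht (by omega) (by omega) (hDdef ▸ hf) hloss hloss' ?_
    have h2 : (if t = 2 then 1 else 0) = if π (p D) = 3 * k + 2 then 1 else 0 :=
      if_congr (by omega) rfl rfl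
    rw [h2]
    rw [← hu] at hcount
    omega

theorem three_le_of_egirth_eq {V : Type*} {G : SimpleGraph V} {g : ℕ}
    (hg : G.egirth = (g : ℕ∞)) : 3 ≤ g := by
  have := G.three_le_egirth
  rw [hg] at this
  exact_mod_cast this

/-- A bridgeless graph has an orientation whose diameter is bounded in terms of `L`. -/
theorem exists_orientation_of_le_degree {V : Type*} [Fintype V] {G : SimpleGraph V}
    [DecidableRel G.Adj] (hconn : G.Connected) (hb : ∀ e : Sym2 V, ¬ G.IsBridge e)
    {δ : ℕ} (hδ : ∀ x, δ ≤ G.degree x) (hδ4 : 4 ≤ δ) {L : ℕ} (hL : 1 ≤ L) :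
    ∃ (D : V → V → Prop) (d : ℕ),
      ((∀ u v, D u v → G.Adj u v) ∧ ∀ u v, G.Adj u v → (D u v ↔ ¬ D v u)) ∧
      d * L * (δ + 1) ≤ (6 * L + 2) * Fintype.card V ∧
      ∀ u v, ∃ m ≤ d + 2 * ((3 * L) ^ 2 + 3 * L), StepReach D m u v := by
  classical
  let P : Finset V → Prop := fun S => S.Nonempty ∧ ∃ (O : V → V → Prop) (d : ℕ),
    IsPartialOrientation G S O ∧ (∀ x ∈ S, ∀ y ∈ S, ∃ m ≤ d, StepReach O m x y) ∧
    d * L * (δ + 1) ≤ (6 * L + 2) * (closedNbhd G S).card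
  obtain ⟨s⟩ := hconn.nonempty
  have hs : P {s} := by
    refine ⟨Finset.singleton_nonempty s, fun _ _ => False, 0,
      ⟨by simp, by simp, by simp, by simp⟩, ?_, by simp⟩
    intro x hx y hy
    rw [Finset.mem_singleton] at hx hy
    exact ⟨0, le_rfl, hx.trans hy.symm⟩
  obtain ⟨S, hS, hmax⟩ := Finset.exists_max_image (Finset.univ.filter P) Finset.card
    ⟨{s}, Finset.mem_filter.2 ⟨Finset.mem_univ _, hs⟩⟩
  obtain ⟨hne, O, d, hO, hd, hcard⟩ := (Finset.mem_filter.1 hS).2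
  have hr : ∀ x, ∃ n ≤ 3 * L, ∃ s ∈ S, StepReach G.Adj n s x := by
    by_contra hfar
    obtain ⟨S', O', f, hSS', hO', hd', hf⟩ := hO.exists_growth hconn hb hδ hδ4 hL hne hd hfar
    have h1 : P S' := by
      refine ⟨hne.mono hSS'.subset, O', d + f, hO', hd', ?_⟩
      calc (d + f) * L * (δ + 1) = d * L * (δ + 1) + f * L * (δ + 1) := by ring
        _ ≤ (6 * L + 2) * (closedNbhd G S').card := by omega
    have h2 := hmax S' (Finset.mem_filter.2 ⟨Finset.mem_univ _, h1⟩)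
    exact absurd (Finset.card_lt_card hSS') (not_lt.2 h2)
  obtain ⟨O', hO', hOO', h⟩ := exists_extension_univ hconn hb (3 * L) hne hO hr
  obtain ⟨D, hD, hO'D⟩ := hO'.exists_isOrientation
  refine ⟨D, d, hD, hcard.trans (Nat.mul_le_mul_left _ (Finset.card_le_univ _)), fun u v => ?_⟩
  obtain ⟨-, n₁, hn₁, s₁, hs₁, h₁⟩ := h u
  obtain ⟨⟨n₂, hn₂, s₂, hs₂, h₂⟩, -⟩ := h v
  obtain ⟨m, hm, h₃⟩ := hd s₁ hs₁ s₂ hs₂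
  exact ⟨n₁ + m + n₂, by omega, (((h₁.trans (h₃.mono hOO')).trans h₂)).mono hO'D⟩

theorem diameter_arithmetic {n d δ g m L : ℕ} {ε : ℝ} (hε : 0 < ε) (hg : 3 ≤ g)
    (hL : L = ⌈((g : ℝ) - 1) / ε⌉₊) (hd : d * L * (δ + 1) ≤ (6 * L + 2) * n)
    (hm : m ≤ d + 2 * ((3 * L) ^ 2 + 3 * L)) :
    (m : ℝ) ≤ (2 * g + ε) * n / (δ + 1) + 4 * Nat.choose (L * g + 1) 2 := by
  have hg' : (3 : ℝ) ≤ g := by exact_mod_cast hg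
  have hL1 : ((g : ℝ) - 1) / ε ≤ L := hL ▸ Nat.le_ceil _
  have hL0 : (0 : ℝ) < L := lt_of_lt_of_le (div_pos (by linarith) hε) hL1
  have hLε : (g : ℝ) - 1 ≤ L * ε := (div_le_iff₀ hε).1 hL1
  have hδ : (0 : ℝ) < δ + 1 := by positivity
  have hd' : (d : ℝ) ≤ (2 * g + ε) * n / (δ + 1) := by
    rw [le_div_iff₀ hδ]
    have h1 : (d : ℝ) * L * (δ + 1) ≤ (6 * L + 2) * n := by exact_mod_cast hd
    have h2 : (6 * (L : ℝ) + 2) * n ≤ L * ((2 * g + ε) * n) := by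
      have : 6 * (L : ℝ) + 2 ≤ L * (2 * g + ε) := by nlinarith
      calc (6 * (L : ℝ) + 2) * n ≤ L * (2 * g + ε) * n :=
            mul_le_mul_of_nonneg_right this (Nat.cast_nonneg n)
        _ = L * ((2 * g + ε) * n) := by ring
    exact le_of_mul_le_mul_left (by linarith) hL0
  have hc : 2 * ((3 * L) ^ 2 + 3 * L) ≤ 4 * Nat.choose (L * g + 1) 2 := by
    have h1 : Nat.choose (L * g + 1) 2 * 2 = L * g * (L * g + 1) := by
      rw [Nat.choose_two_right, Nat.add_sub_cancel, Nat.div_mul_cancel, mul_comm]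
      rw [mul_comm]
      exact (Nat.even_mul_succ_self _).two_dvd
    have h2 : 3 * L ≤ L * g := by nlinarith
    nlinarith
  have hm' : (m : ℝ) ≤ d + (2 * ((3 * L) ^ 2 + 3 * L) : ℕ) := by exact_mod_cast hm
  have hc' : ((2 * ((3 * L) ^ 2 + 3 * L) : ℕ) : ℝ) ≤ 4 * Nat.choose (L * g + 1) 2 := by
    exact_mod_cast hc
  linarith

/-- For a bridgeless graph `G` of order `n`, minimum degree `δ ≥ 4` and girth
`g`, for every `ε > 0`, with `L = ⌈(g-1)/ε⌉`, the oriented diameter of `G` is at most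
`(2g+ε)·n/(δ+1) + 4·C(Lg+1, 2)`. -/
theorem oriented_diameter_le_of_minDegree
    {V : Type*} [Fintype V] (G : SimpleGraph V) [DecidableRel G.Adj]
    (n δ g : ℕ) (hn : Fintype.card V = n)
    (hG : Bridgeless G) (hδ : G.minDegree = δ) (hδ4 : 4 ≤ δ)
    (hg : G.egirth = (g : ℕ∞)) (ε : ℝ) (hε : 0 < ε) :
    ∃ D : V → V → Prop, IsOrientation G D ∧
      ∀ u v : V, ∃ m : ℕ,
        (m : ℝ) ≤ (2 * g + ε) * n / (δ + 1) +
          4 * Nat.choose (⌈((g : ℝ) - 1) / ε⌉₊ * g + 1) 2 ∧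
        DiReach D u v m := by
  have hδ' : ∀ x, δ ≤ G.degree x := fun x => hδ ▸ G.minDegree_le_degree x
  have hg3 := three_le_of_egirth_eq hg
  have hL : 1 ≤ ⌈((g : ℝ) - 1) / ε⌉₊ := by
    have hg' : (3 : ℝ) ≤ g := by exact_mod_cast hg3
    exact Nat.ceil_pos.2 (div_pos (by linarith) hε)
  obtain ⟨D, d, hD, hd, h⟩ := exists_orientation_of_le_degree hG.1 hG.2 hδ' hδ4 hL
  refine ⟨D, hD, fun u v => ?_⟩
  obtain ⟨m, hm, huv⟩ := h u v
  exact ⟨m, diameter_arithmetic hε hg3 rfl (hn ▸ hd) hm, huv.diReach⟩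
end
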